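/- arXiv:2304.10763 — 2 statements merged into one kernel-verified Lean document; each statement's English description precedes it below -/
import Mathlib

section
/- Let X be a proper geodesically complete CAT(0) space and Γ a closed, cocompact, totally disconnected subgroup of Isom(X). Then every fiber of the quotient map p : X → Γ\X is a discrete subset of X. -/
open Set

/-- A metric space is CAT(0) if midpoints exist and the CN-inequality of Bruhat–Tits holds. -/
def IsCAT0 (X : Type*) [MetricSpace X] : Prop :=
  (∀ x y : X, ∃ m : X, dist x m = dist x y / 2 ∧ dist m y = dist x y / 2) ∧
  ∀ x y z m : X, dist y m = dist y z / 2 → dist m z = dist y z / 2 →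
    dist x m ^ 2 ≤ (dist x y ^ 2 + dist x z ^ 2) / 2 - dist y z ^ 2 / 4

/-- `c` is a unit-speed geodesic parametrized on `[0, L]`. -/
def IsGeodParam {X : Type*} [MetricSpace X] (c : ℝ → X) (L : ℝ) : Prop :=
  ∀ s t : ℝ, s ∈ Icc 0 L → t ∈ Icc 0 L → dist (c s) (c t) = |s - t|

/-- A metric space is geodesically complete if every geodesic segment extends to a complete
geodesic line. -/
def GeodesicallyComplete (X : Type*) [MetricSpace X] : Prop :=
  ∀ (c : ℝ → X) (L : ℝ), 0 ≤ L → IsGeodParam c L →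
    ∃ c' : ℝ → X, (∀ s t : ℝ, dist (c' s) (c' t) = |s - t|) ∧ ∀ t ∈ Icc (0 : ℝ) L, c' t = c t

/-- The isometry group of a proper metric space, with the topology of pointwise convergence
(which coincides with the compact-open topology on isometries of proper spaces). -/
instance isomTopology (X : Type*) [MetricSpace X] : TopologicalSpace (X ≃ᵢ X) :=
  TopologicalSpace.induced (fun g : X ≃ᵢ X => ⇑g) inferInstance

namespace Stmt12Aux

open Filter Topology

variable {X : Type*} [MetricSpace X]

lemma tendsto_isom {ι : Type*} {l : Filter ι} {f : ι → X ≃ᵢ X} {g : X ≃ᵢ X} :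
    Tendsto f l (𝓝 g) ↔ ∀ x, Tendsto (fun i => f i x) l (𝓝 (g x)) := by
  rw [nhds_induced, tendsto_comap_iff, tendsto_pi_nhds]
  rfl

lemma continuous_eval (x : X) : Continuous (fun g : X ≃ᵢ X => g x) :=
  (continuous_apply x).comp continuous_induced_dom

lemma isTopologicalGroup_isom : IsTopologicalGroup (X ≃ᵢ X) where
  continuous_mul := by
    rw [continuous_iff_continuousAt]
    rintro ⟨g, h⟩
    refine tendsto_isom.2 fun x => ?_
    rw [tendsto_iff_dist_tendsto_zero]
    have h1 : Tendsto (fun p : (X ≃ᵢ X) × (X ≃ᵢ X) =>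
        dist (p.2 x) (h x) + dist (p.1 (h x)) (g (h x))) (𝓝 (g, h)) (𝓝 (0 + 0)) := by
      refine Tendsto.add ?_ ?_
      · rw [← tendsto_iff_dist_tendsto_zero]
        exact (((continuous_eval x).comp continuous_snd).tendsto (g, h))
      · rw [← tendsto_iff_dist_tendsto_zero]
        exact (((continuous_eval (h x)).comp continuous_fst).tendsto (g, h))
    rw [add_zero] at h1
    refine squeeze_zero (fun _ => dist_nonneg) (fun p => ?_) h1
    show dist (p.1 (p.2 x)) (g (h x)) ≤ _
    calc _ ≤ dist (p.1 (p.2 x)) (p.1 (h x)) + dist (p.1 (h x)) (g (h x)) := dist_triangle _ _ _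
      _ = _ := by rw [p.1.dist_eq]
  continuous_inv := by
    rw [continuous_iff_continuousAt]
    intro g
    refine tendsto_isom.2 fun x => ?_
    rw [tendsto_iff_dist_tendsto_zero]
    have h1 : Tendsto (fun p : X ≃ᵢ X => dist (p (g⁻¹ x)) (g (g⁻¹ x))) (𝓝 g) (𝓝 0) := by
      rw [← tendsto_iff_dist_tendsto_zero]
      exact (continuous_eval _).tendsto g
    refine h1.congr fun p => ?_
    rw [IsometryEquiv.apply_inv_self, ← p.dist_eq (p⁻¹ x), IsometryEquiv.apply_inv_self, dist_comm]

lemma t2_isom : T2Space (X ≃ᵢ X) :=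
  T2Space.of_injective_continuous (f := fun g : X ≃ᵢ X => (g : X → X))
    DFunLike.coe_injective continuous_induced_dom

lemma isCompact_isom [ProperSpace X] (a b : X) (r : ℝ) :
    IsCompact {g : X ≃ᵢ X | dist (g a) b ≤ r} := by
  rw [isCompact_iff_ultrafilter_le_nhds]
  intro u hu
  have hmem : ∀ᶠ g : X ≃ᵢ X in u, dist (g a) b ≤ r := le_principal_iff.1 hu
  have key : ∀ (φ : (X ≃ᵢ X) → X) (c : X) (R : ℝ), (∀ᶠ g in (u : Filter (X ≃ᵢ X)), dist (φ g) c ≤ R) →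
      ∃ y, Tendsto φ u (𝓝 y) := by
    intro φ c R h
    obtain ⟨y, -, hy⟩ := isCompact_iff_ultrafilter_le_nhds.1 (isCompact_closedBall c R) (u.map φ)
      (le_principal_iff.2 h)
    exact ⟨y, hy⟩
  have h1 : ∀ x : X, ∃ y, Tendsto (fun g : X ≃ᵢ X => g x) u (𝓝 y) := by
    intro x
    refine key _ b (dist x a + r) (hmem.mono fun g hg => ?_)
    have := dist_triangle (g x) (g a) b
    rw [g.dist_eq] at this
    linarith
  have h2 : ∀ x : X, ∃ y, Tendsto (fun g : X ≃ᵢ X => g⁻¹ x) u (𝓝 y) := by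
    intro x
    refine key _ a (dist x b + r) (hmem.mono fun g hg => ?_)
    have h3 := dist_triangle x b (g a)
    rw [← g.dist_eq, IsometryEquiv.apply_inv_self]
    rw [dist_comm b] at h3
    linarith
  choose f hf using h1
  choose h hh using h2
  have hiso : Isometry f := by
    refine Isometry.of_dist_eq fun x y => ?_
    have := (hf x).dist (hf y)
    simp only [IsometryEquiv.dist_eq] at this
    exact (tendsto_nhds_unique this tendsto_const_nhds)
  have hfh : ∀ x, f (h x) = x := by
    intro x
    refine tendsto_nhds_unique (hf (h x)) ?_
    rw [tendsto_iff_dist_tendsto_zero]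
    have := hh x
    rw [tendsto_iff_dist_tendsto_zero] at this
    refine this.congr fun g => ?_
    rw [← g.dist_eq, IsometryEquiv.apply_inv_self, dist_comm]
  refine ⟨IsometryEquiv.mk' f h hfh hiso, ?_, ?_⟩
  · exact le_of_tendsto ((hf a).dist tendsto_const_nhds) hmem
  · exact (tendsto_isom (f := id)).2 hf

/-- Van Dantzig. -/
lemma van_dantzig {H : Type*} [Group H] [TopologicalSpace H] [IsTopologicalGroup H]
    [LocallyCompactSpace H] [T2Space H] [TotallyDisconnectedSpace H] :
    ∃ (Q : Subgroup H) (C : Set H), IsCompact C ∧ (Q : Set H) ⊆ C ∧ (Q : Set H) ∈ 𝓝 (1 : H) := by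
  obtain ⟨K, hK, hK1⟩ := exists_compact_mem_nhds (1 : H)
  obtain ⟨C, hC, h1C, hCK⟩ :=
    (loc_compact_Haus_tot_disc_of_zero_dim (H := H)).mem_nhds_iff.1 hK1
  have hCc : IsCompact C := hK.of_isClosed_subset hC.1 hCK
  let Q : Subgroup H :=
    { carrier := {g | ∀ c, g * c ∈ C ↔ c ∈ C}
      mul_mem' := by
        intro a b ha hb c
        rw [mul_assoc, ha, hb]
      one_mem' := by intro c; simp
      inv_mem' := by
        intro a ha c
        rw [← ha, mul_inv_cancel_left] }
  refine ⟨Q, C, hCc, ?_, ?_⟩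
  · intro g hg
    have := (hg 1).2 h1C
    simpa using this
  · have e1 : ∀ᶠ g in 𝓝 (1 : H), ∀ c ∈ C, g * c ∈ C := by
      refine hCc.eventually_forall_of_forall_eventually fun c hc => ?_
      have : Tendsto (fun z : H × H => z.1 * z.2) (𝓝 (1, c)) (𝓝 (1 * c)) :=
        continuous_mul.tendsto (1, c)
      rw [one_mul] at this
      exact this.eventually (hC.2.mem_nhds hc)
    have e2 : ∀ᶠ g in 𝓝 (1 : H), ∀ c ∈ C, g⁻¹ * c ∈ C := by
      have : Tendsto (fun g : H => g⁻¹) (𝓝 1) (𝓝 1) := by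
        simpa using (continuous_inv.tendsto (1 : H))
      exact this.eventually e1
    filter_upwards [e1, e2] with g h1 h2 c
    refine ⟨fun h => ?_, h1 c⟩
    simpa using h2 _ h

/-- Bruhat–Tits fixed point. -/
lemma circumcenter [ProperSpace X] (hcat : IsCAT0 X) (S : Set X) (hne : S.Nonempty)
    (hb : Bornology.IsBounded S) :
    ∃ z : X, ∀ g : X ≃ᵢ X, (∀ s ∈ S, g⁻¹ s ∈ S) → g z = z := by
  obtain ⟨s0, hs0⟩ := hne
  have : Nonempty S := ⟨⟨s0, hs0⟩⟩
  have : Nonempty X := ⟨s0⟩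
  let r : X → ℝ := fun z => ⨆ b : S, dist z (b : X)
  have hbdd : ∀ z : X, BddAbove (range fun b : S => dist z (b : X)) := by
    intro z
    obtain ⟨R, hR⟩ := hb.subset_closedBall z
    refine ⟨R, ?_⟩
    rintro _ ⟨b, rfl⟩
    have := hR b.2
    rw [Metric.mem_closedBall, dist_comm] at this
    exact this
  have hle : ∀ z, ∀ b ∈ S, dist z b ≤ r z := fun z b hbS => le_ciSup (hbdd z) ⟨b, hbS⟩
  have hr : ∀ z M, (∀ b ∈ S, dist z b ≤ M) → r z ≤ M := fun z M h => ciSup_le fun b => h b b.2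
  have hlip : LipschitzWith 1 r := by
    refine LipschitzWith.of_le_add fun x y => hr _ _ fun b hbS => ?_
    have := dist_triangle x y b
    have := hle y b hbS
    linarith
  obtain ⟨z, hz⟩ := hlip.continuous.exists_forall_le
    (tendsto_atTop_mono (fun z => hle z s0 hs0) (tendsto_dist_right_cocompact_atTop s0))
  refine ⟨z, fun g hg => ?_⟩
  have hgz : r (g z) ≤ r z := by
    refine hr _ _ fun b hbS => ?_
    have := hle z _ (hg b hbS)
    rwa [← g.dist_eq, IsometryEquiv.apply_inv_self] at this
  obtain ⟨m, hm1, hm2⟩ := hcat.1 (g z) z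
  have hr0 : 0 ≤ r z := dist_nonneg.trans (hle z s0 hs0)
  have hm : ∀ b ∈ S, dist m b ^ 2 ≤ r z ^ 2 - dist (g z) z ^ 2 / 4 := by
    intro b hbS
    have h1 := hcat.2 b (g z) z m hm1 hm2
    have h2 := (hle _ b hbS).trans hgz
    have h3 := hle z b hbS
    rw [dist_comm b, dist_comm b, dist_comm b] at h1
    have h4 := pow_le_pow_left₀ dist_nonneg h2 2
    have h5 := pow_le_pow_left₀ dist_nonneg h3 2
    linarith
  have h6 : r m ≤ √(r z ^ 2 - dist (g z) z ^ 2 / 4) :=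
    hr _ _ fun b hbS => Real.le_sqrt_of_sq_le (hm b hbS)
  have h7 := (hz m).trans h6
  have h8 : 0 ≤ r z ^ 2 - dist (g z) z ^ 2 / 4 := (sq_nonneg _).trans (hm s0 hs0)
  have h9 := (Real.le_sqrt hr0 h8).1 h7
  have h10 : dist (g z) z ^ 2 = 0 := le_antisymm (by linarith) (sq_nonneg _)
  exact dist_eq_zero.1 (pow_eq_zero_iff (by norm_num) |>.1 h10)

lemma chain (hcat : IsCAT0 X) (n : ℕ) : ∀ p q : X, ∃ P : ℕ → X, P 0 = p ∧ P (2 ^ n) = q ∧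
    ∀ i < 2 ^ n, dist (P i) (P (i + 1)) ≤ dist p q / 2 ^ n := by
  induction n with
  | zero =>
    intro p q
    refine ⟨fun i => if i = 0 then p else q, by simp, by simp, ?_⟩
    intro i hi
    have : i = 0 := by simpa using hi
    subst this
    simp
  | succ n ih =>
    intro p q
    obtain ⟨m, h1, h2⟩ := hcat.1 p q
    obtain ⟨P, hP0, hP1, hP⟩ := ih p m
    obtain ⟨Q, hQ0, hQ1, hQ⟩ := ih m q
    rw [h1] at hP
    rw [h2] at hQ
    have e : dist p q / 2 ^ (n + 1) = dist p q / 2 / 2 ^ n := by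
      rw [pow_succ]; field_simp
    have e2 : 2 ^ (n + 1) = 2 ^ n + 2 ^ n := by rw [pow_succ]; ring
    have hpos : 0 < 2 ^ n := by positivity
    refine ⟨fun i => if i ≤ 2 ^ n then P i else Q (i - 2 ^ n), by simp [hP0], ?_, ?_⟩
    · rw [e2]
      simp [hQ1]
    · intro i hi
      rw [e]
      rcases lt_trichotomy i (2 ^ n) with h | h | h
      · have h' : i + 1 ≤ 2 ^ n := h
        simp only [h.le, h', if_true]
        exact hP i h
      · subst h
        simp only [le_refl, if_true, hP1]
        rw [if_neg (by omega), Nat.add_sub_cancel_left, ← hQ0]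
        simpa using hQ 0 hpos
      · simp only []
        rw [if_neg (by omega), if_neg (by omega), Nat.sub_add_comm h.le]
        exact hQ _ (by omega)

lemma chain_le {P : ℕ → X} {N : ℕ} {δ : ℝ} (h : ∀ i < N, dist (P i) (P (i + 1)) ≤ δ)
    {i j : ℕ} (hij : i ≤ j) (hj : j ≤ N) : dist (P i) (P j) ≤ (j - i : ℝ) * δ := by
  induction j, hij using Nat.le_induction with
  | base => simp
  | succ j hij ih =>
    have h1 := ih (by omega)
    have h2 := h j (by omega)
    have h3 := dist_triangle (P i) (P j) (P (j + 1))
    push_cast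
    linarith

lemma chain_eq {P : ℕ → X} {N : ℕ} {δ : ℝ} (h : ∀ i < N, dist (P i) (P (i + 1)) ≤ δ)
    (hN : dist (P 0) (P N) = N * δ)
    {i j : ℕ} (hi : i ≤ N) (hj : j ≤ N) : dist (P i) (P j) = |(i : ℝ) * δ - j * δ| := by
  wlog hij : i ≤ j generalizing i j
  · rw [dist_comm, abs_sub_comm]
    exact this hj hi (by omega)
  have hδ : 0 ≤ (j - i : ℝ) * δ := dist_nonneg.trans (chain_le h hij hj)
  have h1 := chain_le h hij hj
  have h2 := chain_le h (Nat.zero_le i) hi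
  have h3 := chain_le h hj le_rfl
  have h4 := dist_triangle4 (P 0) (P i) (P j) (P N)
  rw [abs_sub_comm, abs_of_nonneg (by linarith)]
  push_cast at h2
  linarith

lemma exists_geod [ProperSpace X] (hcat : IsCAT0 X) (p q : X) (hpq : p ≠ q) :
    ∃ c : ℝ → X, IsGeodParam c (dist p q) ∧ c 0 = p ∧ c (dist p q) = q := by
  set L := dist p q with hL
  have hL0 : 0 < L := dist_pos.2 hpq
  choose P hP0 hP1 hP using fun n => chain hcat n p q
  let δ : ℕ → ℝ := fun n => L / 2 ^ n
  have hδ : ∀ n, 0 < δ n := fun n => by positivity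
  have hNδ : ∀ n, (2 ^ n : ℝ) * δ n = L := fun n => by simp only [δ]; field_simp
  have hδt : Tendsto δ atTop (𝓝 0) := by
    have := (tendsto_pow_atTop_nhds_zero_of_lt_one (r := (1 / 2 : ℝ)) (by norm_num)
      (by norm_num)).const_mul L
    rw [mul_zero] at this
    refine this.congr fun n => ?_
    simp [δ, div_eq_mul_inv]
  have hd : ∀ n i j, i ≤ 2 ^ n → j ≤ 2 ^ n →
      dist (P n i) (P n j) = |(i : ℝ) * δ n - j * δ n| := by
    intro n i j hi hj
    refine chain_eq (hP n) ?_ hi hj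
    rw [hP0, hP1]
    push_cast
    exact (hNδ n).symm
  let k : ℕ → ℝ → ℕ := fun n t => ⌊t / δ n⌋₊
  have hk : ∀ n t, t ∈ Icc 0 L → k n t ≤ 2 ^ n := by
    intro n t ht
    refine Nat.floor_le_of_le ?_
    rw [div_le_iff₀ (hδ n)]
    push_cast
    rw [hNδ]
    exact ht.2
  have hkt : ∀ t ∈ Icc 0 L, Tendsto (fun n => (k n t : ℝ) * δ n) atTop (𝓝 t) := by
    intro t ht
    rw [tendsto_iff_dist_tendsto_zero]
    refine squeeze_zero (fun _ => dist_nonneg) (fun n => ?_) hδt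
    have h1 : (k n t : ℝ) ≤ t / δ n := Nat.floor_le (div_nonneg ht.1 (hδ n).le)
    have h2 : t / δ n < k n t + 1 := Nat.lt_floor_add_one _
    rw [le_div_iff₀ (hδ n)] at h1
    rw [div_lt_iff₀ (hδ n)] at h2
    rw [Real.dist_eq, abs_le]
    constructor <;> nlinarith [hδ n]
  let u : Ultrafilter ℕ := Ultrafilter.of atTop
  have hu : (u : Filter ℕ) ≤ atTop := Ultrafilter.of_le atTop
  have hlim : ∀ t, ∃ y, t ∈ Icc 0 L → Tendsto (fun n => P n (k n t)) u (𝓝 y) := by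
    intro t
    by_cases ht : t ∈ Icc 0 L
    · have hmem : ∀ n, dist (P n (k n t)) p ≤ L := by
        intro n
        rw [← hP0 n, hd n _ _ (hk n t ht) (Nat.zero_le _)]
        have h1 : (k n t : ℝ) ≤ 2 ^ n := by exact_mod_cast hk n t ht
        have := mul_le_mul_of_nonneg_right h1 (hδ n).le
        rw [hNδ] at this
        simpa [abs_of_nonneg (hδ n).le] using this
      have hev : ∀ᶠ n in (u : Filter ℕ), P n (k n t) ∈ Metric.closedBall p L :=
        Eventually.of_forall hmem
      obtain ⟨y, -, hy⟩ := isCompact_iff_ultrafilter_le_nhds.1 (isCompact_closedBall p L)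
        (u.map (fun n => P n (k n t))) (le_principal_iff.2 hev)
      exact ⟨y, fun _ => hy⟩
    · exact ⟨p, fun h => absurd h ht⟩
  choose c hc using hlim
  have h0 : (0 : ℝ) ∈ Icc 0 L := ⟨le_rfl, hL0.le⟩
  have h1 : L ∈ Icc 0 L := ⟨hL0.le, le_rfl⟩
  refine ⟨c, fun s t hs ht => ?_, ?_, ?_⟩
  · refine tendsto_nhds_unique ((hc s hs).dist (hc t ht)) ?_
    have := (((hkt s hs).sub (hkt t ht)).abs).mono_left hu
    refine this.congr fun n => ?_
    rw [hd n _ _ (hk n s hs) (hk n t ht)]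
  · refine tendsto_nhds_unique (hc 0 h0) (tendsto_const_nhds.congr fun n => ?_)
    simp [k, hP0]
  · refine tendsto_nhds_unique (hc L h1) (tendsto_const_nhds.congr fun n => ?_)
    have : k n L = 2 ^ n := by
      have e : L / δ n = ((2 ^ n : ℕ) : ℝ) := by
        rw [div_eq_iff (hδ n).ne']
        push_cast
        exact (hNδ n).symm
      simp only [k]
      rw [e, Nat.floor_natCast]
    rw [this, hP1]

/-- If an isometry moves `p` a little, some far away point `z` detects it. -/
lemma detect [ProperSpace X] (hcat : IsCAT0 X) (hgc : GeodesicallyComplete X)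
    {D : ℝ} (hD : 0 ≤ D) (p q : X) (hpq : p ≠ q) (h1 : dist p q ≤ 1) :
    ∃ z, dist p z ≤ 4 * D + 1 ∧ ∀ f, dist f z ≤ D → dist f q ≠ dist f p := by
  obtain ⟨c, hc, hc0, hc1⟩ := exists_geod hcat p q hpq
  obtain ⟨l, hl, hlc⟩ := hgc c _ dist_nonneg hc
  set ε := dist p q with hε
  have hε0 : 0 < ε := dist_pos.2 hpq
  have hl0 : l 0 = p := by rw [hlc 0 ⟨le_rfl, hε0.le⟩, hc0]
  have hl1 : l ε = q := by rw [hlc ε ⟨hε0.le, le_rfl⟩, hc1]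
  have hex : ∃ k : ℕ, 2 * D < 2 ^ k * ε := by
    obtain ⟨k, hk⟩ := pow_unbounded_of_one_lt (2 * D / ε) (one_lt_two)
    exact ⟨k, by rwa [div_lt_iff₀ hε0] at hk⟩
  classical
  obtain ⟨k, hk, hkmin⟩ : ∃ k : ℕ, 2 * D < 2 ^ k * ε ∧ 2 ^ k * ε ≤ 4 * D + 1 := by
    refine ⟨Nat.find hex, Nat.find_spec hex, ?_⟩
    rcases Nat.eq_zero_or_eq_succ_pred (Nat.find hex) with h | h
    · rw [h]; linarith
    · have := Nat.find_min hex (m := (Nat.find hex).pred) (by omega)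
      rw [h, pow_succ]
      linarith
  refine ⟨l (2 ^ k * ε), ?_, fun f hf heq => ?_⟩
  · rw [← hl0, hl, zero_sub, abs_neg, abs_of_pos (by positivity)]
    exact hkmin
  have hstep : ∀ j : ℕ, dist f p ^ 2 + (2 ^ j * ε) ^ 2 - 2 ^ j * ε ^ 2 ≤
      dist f (l (2 ^ j * ε)) ^ 2 := by
    intro j
    induction j with
    | zero => simp [hl1, heq]
    | succ j ih =>
      have ht : 0 < 2 ^ j * ε := by positivity
      have e : (2 : ℝ) ^ (j + 1) * ε = 2 * (2 ^ j * ε) := by rw [pow_succ]; ring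
      have e' : (2 : ℝ) ^ (j + 1) * ε ^ 2 = 2 * (2 ^ j * ε ^ 2) := by rw [pow_succ]; ring
      rw [e, e']
      set t := 2 ^ j * ε
      have d0 : dist p (l (2 * t)) = 2 * t := by
        rw [← hl0, hl, zero_sub, abs_neg, abs_of_pos (by positivity)]
      have d1 : dist p (l t) = t := by
        rw [← hl0, hl, zero_sub, abs_neg, abs_of_pos ht]
      have d2 : dist (l t) (l (2 * t)) = t := by
        rw [hl, abs_sub_comm, abs_of_pos (by linarith)]; ring
      have := hcat.2 f p (l (2 * t)) (l t) (by rw [d0, d1]; ring) (by rw [d0, d2]; ring)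
      rw [d0] at this
      nlinarith
  have hs := hstep k
  have h2 : (1 : ℝ) ≤ 2 ^ k := one_le_pow₀ (by norm_num)
  have h3 : (2 : ℝ) ^ k * ε ^ 2 ≤ (2 ^ k * ε) ^ 2 := by
    rw [mul_pow]
    have : (2 : ℝ) ^ k ≤ (2 ^ k) ^ 2 := by nlinarith
    exact mul_le_mul_of_nonneg_right this (sq_nonneg _)
  have h4 : dist f p ^ 2 ≤ dist f (l (2 ^ k * ε)) ^ 2 := by linarith
  have h5 : dist f p ≤ dist f (l (2 ^ k * ε)) := (pow_le_pow_iff_left₀ dist_nonneg dist_nonneg (by norm_num)).1 h4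
  have h6 : dist p (l (2 ^ k * ε)) = 2 ^ k * ε := by
    rw [← hl0, hl, zero_sub, abs_neg, abs_of_pos (by positivity)]
  have h7 := dist_triangle p f (l (2 ^ k * ε))
  rw [dist_comm p f] at h7
  linarith

/-- The stabilizer of `p` in `G` is open. -/
def Good (G : Subgroup (X ≃ᵢ X)) (p : X) : Prop :=
  ∀ᶠ g : G in 𝓝 1, (g : X ≃ᵢ X) p = p

lemma continuous_evalG (G : Subgroup (X ≃ᵢ X)) (x : X) :
    Continuous (fun g : G => (g : X ≃ᵢ X) x) :=
  (continuous_eval x).comp continuous_subtype_val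

lemma isCompact_G [ProperSpace X] (G : Subgroup (X ≃ᵢ X))
    (hclosed : IsClosed (G : Set (X ≃ᵢ X))) (a b : X) (r : ℝ) :
    IsCompact {g : G | dist ((g : X ≃ᵢ X) a) b ≤ r} :=
  hclosed.isClosedEmbedding_subtypeVal.isCompact_preimage (isCompact_isom a b r)

lemma finite_orbit [ProperSpace X] (G : Subgroup (X ≃ᵢ X))
    (hclosed : IsClosed (G : Set (X ≃ᵢ X))) {y : X} (hy : Good G y) (b : X) (r : ℝ) :
    {z : X | (∃ g : G, z = (g : X ≃ᵢ X) y) ∧ dist z b ≤ r}.Finite := by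
  have := isTopologicalGroup_isom (X := X)
  obtain ⟨t, -, ht⟩ := (isCompact_G G hclosed y b r).elim_nhds_subcover
    (fun g => {h : G | (h : X ≃ᵢ X) y = (g : X ≃ᵢ X) y}) (fun g _ => by
      have h1 : Tendsto (fun h : G => g⁻¹ * h) (𝓝 g) (𝓝 (g⁻¹ * g)) :=
        (continuous_const_mul g⁻¹).tendsto g
      rw [inv_mul_cancel] at h1
      filter_upwards [h1.eventually hy] with h hh
      have := congrArg (g : X ≃ᵢ X) hh
      simpa [IsometryEquiv.mul_apply] using this)
  refine (t.finite_toSet.image (fun g : G => (g : X ≃ᵢ X) y)).subset ?_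
  rintro z ⟨⟨g, rfl⟩, hz⟩
  obtain ⟨h, hht, hh⟩ := mem_iUnion₂.1 (ht (show g ∈ _ from hz))
  exact ⟨h, hht, hh.symm⟩

lemma Good.smul {G : Subgroup (X ≃ᵢ X)} {y : X} (hy : Good G y) (h : G) :
    Good G ((h : X ≃ᵢ X) y) := by
  have := isTopologicalGroup_isom (X := X)
  have h1 : Tendsto (fun g : G => h⁻¹ * g * h) (𝓝 1) (𝓝 (h⁻¹ * 1 * h)) :=
    (by fun_prop : Continuous (fun g : G => h⁻¹ * g * h)).tendsto 1
  rw [mul_one, inv_mul_cancel] at h1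
  filter_upwards [h1.eventually hy] with g hg
  have := congrArg (h : X ≃ᵢ X) hg
  simpa [IsometryEquiv.mul_apply] using this

lemma exists_good [ProperSpace X] [Nonempty X] (hcat : IsCAT0 X) (G : Subgroup (X ≃ᵢ X))
    (hclosed : IsClosed (G : Set (X ≃ᵢ X))) (htd : TotallyDisconnectedSpace G) :
    ∃ x, Good G x := by
  have := isTopologicalGroup_isom (X := X)
  have := t2_isom (X := X)
  obtain ⟨a⟩ := ‹Nonempty X›
  have hlc : LocallyCompactSpace G := by
    refine (isCompact_G G hclosed a a 1).locallyCompactSpace_of_mem_nhds_of_group (x := 1) ?_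
    have h1 := (continuous_evalG G a).tendsto 1
    exact h1.eventually (Metric.closedBall_mem_nhds _ one_pos)
  obtain ⟨Q, C, hC, hQC, hQ⟩ := van_dantzig (H := G)
  obtain ⟨z, hz⟩ := circumcenter hcat ((fun g : G => (g : X ≃ᵢ X) a) '' Q)
    ⟨_, 1, Q.one_mem, rfl⟩
    ((hC.image (continuous_evalG G a)).isBounded.subset (image_mono hQC))
  refine ⟨z, ?_⟩
  filter_upwards [hQ] with g hg
  refine hz g ?_
  rintro _ ⟨h, hh, rfl⟩
  exact ⟨g⁻¹ * h, Q.mul_mem (Q.inv_mem hg) hh, rfl⟩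

lemma good_all [ProperSpace X] (hcat : IsCAT0 X) (hgc : GeodesicallyComplete X)
    (G : Subgroup (X ≃ᵢ X))
    (hclosed : IsClosed (G : Set (X ≃ᵢ X)))
    (htd : TotallyDisconnectedSpace ↥G)
    {D : ℝ} (hcoc : ∀ x y : X, ∃ g ∈ G, dist y (g x) ≤ D) (p : X) : Good G p := by
  have : Nonempty X := ⟨p⟩
  obtain ⟨x, hx⟩ := exists_good hcat G hclosed htd
  have hD : 0 ≤ D := by
    obtain ⟨g, -, hg⟩ := hcoc p p
    exact dist_nonneg.trans hg
  have hfin := finite_orbit G hclosed hx p (5 * D + 1)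
  have e1 : ∀ᶠ g : G in 𝓝 1, ∀ f ∈ {z : X | (∃ g : G, z = (g : X ≃ᵢ X) x) ∧
      dist z p ≤ 5 * D + 1}, (g : X ≃ᵢ X) f = f := by
    rw [hfin.eventually_all]
    rintro f ⟨⟨h, rfl⟩, -⟩
    exact hx.smul h
  have e2 : ∀ᶠ g : G in 𝓝 1, dist ((g : X ≃ᵢ X) p) p ≤ 1 :=
    ((continuous_evalG G p).tendsto 1).eventually (Metric.closedBall_mem_nhds _ one_pos)
  filter_upwards [e1, e2] with g h1 h2
  by_contra hne
  obtain ⟨z, hz, hzf⟩ := detect hcat hgc hD p ((g : X ≃ᵢ X) p) (Ne.symm hne)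
    (by rwa [dist_comm])
  obtain ⟨h, hG, hh⟩ := hcoc x z
  rw [dist_comm] at hh
  refine hzf (h x) hh ?_
  have h3 := h1 (h x) ⟨⟨⟨h, hG⟩, rfl⟩, by
    have := dist_triangle (h x) z p
    rw [dist_comm z p] at this
    linarith⟩
  conv_lhs => rw [← h3]
  exact (g : X ≃ᵢ X).dist_eq _ _

end Stmt12Aux

/-- Let `X` be a proper geodesically complete CAT(0) space and `Γ` a
closed, cocompact, totally disconnected subgroup of `Isom(X)`.  Then every orbit `Γy` is a
discrete subset of `X` (it has no accumulation points). -/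
theorem stmt12 {X : Type*} [MetricSpace X] [ProperSpace X]
    (hcat : IsCAT0 X) (hgc : GeodesicallyComplete X)
    (G : Subgroup (X ≃ᵢ X))
    (hclosed : IsClosed (G : Set (X ≃ᵢ X)))
    (htd : TotallyDisconnectedSpace ↥G)
    {D : ℝ} (hcoc : ∀ x y : X, ∃ g ∈ G, dist y (g x) ≤ D) :
    ∀ y x : X, ¬ AccPt x (Filter.principal {z : X | ∃ g ∈ G, z = g y}) := by
  intro y x hacc
  have hgood := Stmt12Aux.good_all hcat hgc G hclosed htd hcoc y
  have hfin := Stmt12Aux.finite_orbit G hclosed hgood x 1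
  rw [accPt_iff_frequently] at hacc
  have hball : ∀ᶠ z in nhds x, dist z x ≤ 1 := Metric.closedBall_mem_nhds x one_pos
  have hout := (hfin.subset (sdiff_subset (t := {x}))).isClosed.isOpen_compl.mem_nhds
    (show x ∈ _ by simp)
  obtain ⟨z, ⟨hzx, g, hg, hz⟩, hb, ho⟩ := (hacc.and_eventually (hball.and hout)).exists
  exact ho ⟨⟨⟨⟨g, hg⟩, hz⟩, hb⟩, hzx⟩
end

section
/- Let X be a proper geodesically complete CAT(0) space and Γ a closed, cocompact, totally disconnected group of isometries of X. Then the Hausdorff dimension and topological dimension of the quotient metric space M = Γ\X satisfy HD(M) = HD(X) = TD(X) = TD(M). -/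
open Set
open scoped ENNReal

/-- Lebesgue covering dimension is at most `n`: every open cover refines to an open cover of
multiplicity at most `n + 1`. -/
def DimLE (X : Type*) [TopologicalSpace X] (n : ℕ) : Prop :=
  ∀ (ι : Type) (U : ι → Set X), (∀ i, IsOpen (U i)) → (⋃ i, U i) = univ →
    ∃ (κ : Type) (V : κ → Set X), (∀ j, IsOpen (V j)) ∧ (⋃ j, V j) = univ ∧
      (∀ j, ∃ i, V j ⊆ U i) ∧
      ∀ x : X, {j : κ | x ∈ V j}.Finite ∧ {j : κ | x ∈ V j}.ncard ≤ n + 1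

/-- The topological (covering) dimension, as an extended nonnegative real. -/
noncomputable def topDimE (X : Type*) [TopologicalSpace X] : ℝ≥0∞ :=
  ⨅ n ∈ {n : ℕ | DimLE X n}, (n : ℝ≥0∞)



/-- A complete unit speed geodesic line. -/
def IsLine {X : Type*} [MetricSpace X] (c : ℝ → X) : Prop :=
  ∀ s t : ℝ, dist (c s) (c t) = |s - t|

namespace CatGeo

theorem convex_of_midpoint {f : ℝ → ℝ} (hf : Continuous f)
    (h : ∀ a b, f ((a + b) / 2) ≤ (f a + f b) / 2) (a b l : ℝ) (hl0 : 0 ≤ l) (hl1 : l ≤ 1) :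
    f ((1 - l) * a + l * b) ≤ (1 - l) * f a + l * f b := by
  by_contra hcon
  push Not at hcon
  set g : ℝ → ℝ := fun l => f ((1 - l) * a + l * b) - ((1 - l) * f a + l * f b) with hg
  have hgc : Continuous g := by fun_prop
  have hgm : ∀ u v, g ((u + v) / 2) ≤ (g u + g v) / 2 := by
    intro u v
    have := h ((1 - u) * a + u * b) ((1 - v) * a + v * b)
    have e : ((1 - u) * a + u * b + ((1 - v) * a + v * b)) / 2
        = (1 - (u + v) / 2) * a + (u + v) / 2 * b := by ring
    rw [e] at this
    simp only [hg]
    linarith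
  have g0 : g 0 = 0 := by simp [hg]
  have g1 : g 1 = 0 := by simp [hg]
  have gl : 0 < g l := by simp only [hg]; linarith
  obtain ⟨m, hm, hmax⟩ := isCompact_Icc.exists_isMaxOn (⟨l, hl0, hl1⟩ : (Icc (0:ℝ) 1).Nonempty)
    hgc.continuousOn
  have hmax' : ∀ t ∈ Icc (0:ℝ) 1, g t ≤ g m := hmax
  have hcs : IsCompact (Icc (0:ℝ) 1 ∩ {t | g t = g m}) :=
    isCompact_Icc.inter_right (isClosed_eq hgc continuous_const)
  obtain ⟨t0, ht0, hmin⟩ := hcs.exists_isMinOn ⟨m, hm, rfl⟩ continuous_id.continuousOn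
  have hmin' : ∀ t ∈ Icc (0:ℝ) 1 ∩ {t | g t = g m}, t0 ≤ t := hmin
  have ht0e : g t0 = g m := ht0.2
  have hpos : 0 < g t0 := by rw [ht0e]; exact gl.trans_le (hmax' l ⟨hl0, hl1⟩)
  have h0 : 0 < t0 := lt_of_le_of_ne ht0.1.1 (by rintro rfl; linarith)
  have h1 : t0 < 1 := lt_of_le_of_ne ht0.1.2 (by rintro rfl; linarith)
  set d := min t0 (1 - t0) / 2 with hd
  have hdp : 0 < d := by rw [hd]; have := lt_min h0 (sub_pos.2 h1); linarith
  have hd1 : d ≤ t0 := by rw [hd]; have := min_le_left t0 (1 - t0); linarith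
  have hd2 : d ≤ 1 - t0 := by
    rw [hd]; have := min_le_right t0 (1 - t0); linarith
  have k1 := hgm (t0 - d) (t0 + d)
  have e1 : (t0 - d + (t0 + d)) / 2 = t0 := by ring
  rw [e1] at k1
  have k2 := hmax' (t0 + d) ⟨by linarith, by linarith⟩
  have k3 := hmax' (t0 - d) ⟨by linarith, by linarith⟩
  have k4 : g (t0 - d) = g m := by linarith
  have := hmin' (t0 - d) ⟨⟨by linarith, by linarith⟩, k4⟩
  linarith

theorem le_of_sq_le_sq_aux {a b : ℝ} (hb : 0 ≤ b) (h : a ^ 2 ≤ b ^ 2) : a ≤ b :=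
  le_of_abs_le (abs_le_of_sq_le_sq h hb)

variable {X : Type*} [MetricSpace X]

theorem between [ProperSpace X] (hcat : IsCAT0 X) (x y : X) (t : ℝ) (h0 : 0 ≤ t)
    (h1 : t ≤ dist x y) : ∃ m, dist x m = t ∧ dist m y = dist x y - t := by
  set L := dist x y with hL
  set S : Set (X × X) := {q | dist x q.1 + dist q.1 q.2 + dist q.2 y = L ∧ dist x q.1 ≤ t ∧
    t ≤ dist x q.1 + dist q.1 q.2} with hS
  have hSc : IsClosed S := by
    have c1 : IsClosed {q : X × X | dist x q.1 + dist q.1 q.2 + dist q.2 y = L} :=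
      isClosed_eq (by fun_prop) (by fun_prop)
    have c2 : IsClosed {q : X × X | dist x q.1 ≤ t} := isClosed_le (by fun_prop) (by fun_prop)
    have c3 : IsClosed {q : X × X | t ≤ dist x q.1 + dist q.1 q.2} :=
      isClosed_le (by fun_prop) (by fun_prop)
    exact c1.inter (c2.inter c3)
  have hSK : IsCompact S := by
    refine ((isCompact_closedBall x L).prod (isCompact_closedBall x L)).of_isClosed_subset hSc ?_
    rintro ⟨m, n⟩ ⟨h1, h2, h3⟩
    simp only at h1 h2 h3
    have := dist_nonneg (x := n) (y := y)
    have := dist_nonneg (x := m) (y := n)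
    have := dist_triangle x m n
    refine ⟨?_, ?_⟩ <;> simp only [Metric.mem_closedBall, dist_comm _ x] <;> linarith
  obtain ⟨⟨m, n⟩, ⟨k1, k2, k3⟩, hmin⟩ := hSK.exists_isMinOn (f := fun q => dist q.1 q.2)
    ⟨(x, y), by simp [hL], by simpa using h0, by simpa using h1⟩
    (by fun_prop)
  simp only at k1 k2 k3
  have hmin' : ∀ q ∈ S, dist m n ≤ dist q.1 q.2 := hmin
  obtain ⟨o, o1, o2⟩ := hcat.1 m n
  have tri1 := dist_triangle x m o
  have tri2 := dist_triangle o n y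
  have tri3 := dist_triangle x o y
  have hd : dist m n = 0 := by
    have hn := dist_nonneg (x := m) (y := n)
    rcases le_total t (dist x m + dist m o) with h | h
    · have := hmin' (m, o) ⟨by simp only; linarith, k2, h⟩
      simp only at this
      linarith
    · have := hmin' (o, n) ⟨by simp only; linarith, by simp only; linarith,
        by simp only; linarith⟩
      simp only at this
      linarith
  have : m = n := dist_eq_zero.1 hd
  subst this
  refine ⟨m, ?_, ?_⟩ <;> linarith

theorem between_unique (hcat : IsCAT0 X) {x y m n : X} {t : ℝ} 
    (h1 : dist x m = t) (h2 : dist m y = dist x y - t) (h3 : dist x n = t)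
    (h4 : dist n y = dist x y - t) : m = n := by
  obtain ⟨o, o1, o2⟩ := hcat.1 m n
  have c1 := hcat.2 x m n o o1 o2
  have c2 := hcat.2 y m n o o1 o2
  rw [dist_comm y m, dist_comm y n, dist_comm y o] at c2
  rw [h1, h3] at c1
  rw [h2, h4] at c2
  have tri := dist_triangle x o y
  have hn := dist_nonneg (x := m) (y := n)
  by_contra hne
  have hp : 0 < dist m n := dist_pos.2 hne
  have t0 : 0 ≤ t := by rw [← h1]; exact dist_nonneg
  have t1 : 0 ≤ dist x y - t := by rw [← h2]; exact dist_nonneg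
  have e1 : dist x o < t := by
    apply lt_of_pow_lt_pow_left₀ 2 t0; nlinarith
  have e2 : dist o y < dist x y - t := by
    apply lt_of_pow_lt_pow_left₀ 2 t1; nlinarith
  linarith

theorem exists_line [ProperSpace X] (hcat : IsCAT0 X) (hgc : GeodesicallyComplete X) (x y : X) :
    ∃ c : ℝ → X, IsLine c ∧ c 0 = x ∧ c (dist x y) = y := by
  have hb := between hcat x y
  set L := dist x y with hL
  have hL0 : 0 ≤ L := dist_nonneg
  have hb' : ∀ t, ∃ m, t ∈ Icc 0 L → dist x m = t ∧ dist m y = L - t := by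
    intro t
    by_cases ht : t ∈ Icc 0 L
    · obtain ⟨m, hm⟩ := hb t ht.1 ht.2
      exact ⟨m, fun _ => hm⟩
    · exact ⟨x, fun h => absurd h ht⟩
  choose c hc using hb'
  have key : ∀ s t, s ∈ Icc 0 L → t ∈ Icc 0 L → s ≤ t → dist (c s) (c t) = t - s := by
    intro s t hs ht hst
    obtain ⟨m, m1, m2⟩ := between hcat x (c t) s hs.1 (by rw [(hc t ht).1]; exact hst)
    rw [(hc t ht).1] at m2
    have t1 := dist_triangle m (c t) y
    have t2 := dist_triangle x m y
    have : m = c s := between_unique hcat m1 (by rw [(hc t ht).2] at t1; linarith)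
      (hc s hs).1 (hc s hs).2
    rw [← this, m2]
  have hgeo : IsGeodParam c L := by
    intro s t hs ht
    rcases le_total s t with h | h
    · rw [key s t hs ht h, abs_of_nonpos (by linarith)]; ring
    · rw [dist_comm, key t s ht hs h, abs_of_nonneg (by linarith)]
  obtain ⟨c', h1, h2⟩ := hgc c L hL0 hgeo
  refine ⟨c', h1, ?_, ?_⟩
  · rw [h2 0 ⟨le_rfl, hL0⟩]
    exact (dist_eq_zero.1 (hc 0 ⟨le_rfl, hL0⟩).1).symm
  · rw [h2 L ⟨hL0, le_rfl⟩]
    apply dist_eq_zero.1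
    rw [(hc L ⟨hL0, le_rfl⟩).2]; ring

theorem IsLine.continuous {c : ℝ → X} (hc : IsLine c) : Continuous c :=
  (Isometry.of_dist_eq (fun s t => by rw [hc, Real.dist_eq])).continuous

theorem IsLine.rev {c : ℝ → X} (hc : IsLine c) (a : ℝ) : IsLine (fun t => c (a - t)) := by
  intro s t
  show dist (c (a - s)) (c (a - t)) = |s - t|
  rw [hc, abs_sub_comm]; congr 1; ring

theorem IsLine.shift {c : ℝ → X} (hc : IsLine c) (a : ℝ) : IsLine (fun t => c (a + t)) := by
  intro s t
  show dist (c (a + s)) (c (a + t)) = |s - t|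
  rw [hc]; congr 1; ring

theorem mid_line (hcat : IsCAT0 X) {c : ℝ → X} (hc : IsLine c) (p : X) (a b : ℝ) :
    dist p (c ((a + b) / 2)) ^ 2 ≤ (dist p (c a) ^ 2 + dist p (c b) ^ 2) / 2
      - (a - b) ^ 2 / 4 := by
  have := hcat.2 p (c a) (c b) (c ((a + b) / 2))
    (by rw [hc, hc, show a - (a + b) / 2 = (a - b) / 2 by ring, abs_div]; norm_num)
    (by rw [hc, hc, show (a + b) / 2 - b = (a - b) / 2 by ring, abs_div]; norm_num)
  rwa [hc, sq_abs] at this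

theorem cn_line (hcat : IsCAT0 X) {c : ℝ → X} (hc : IsLine c) (p : X) (a b l : ℝ)
    (h0 : 0 ≤ l) (h1 : l ≤ 1) :
    dist p (c ((1 - l) * a + l * b)) ^ 2 ≤ (1 - l) * dist p (c a) ^ 2 + l * dist p (c b) ^ 2
      - l * (1 - l) * (b - a) ^ 2 := by
  have hcc := IsLine.continuous hc
  have := convex_of_midpoint (f := fun t => dist p (c t) ^ 2 - t ^ 2) (by fun_prop)
    (by
      intro a b
      have := mid_line hcat hc p a b
      nlinarith) a b l h0 h1
  nlinarith

theorem convex_dist (hcat : IsCAT0 X) {c : ℝ → X} (hc : IsLine c) (p : X) (a b l : ℝ)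
    (h0 : 0 ≤ l) (h1 : l ≤ 1) :
    dist p (c ((1 - l) * a + l * b)) ≤ (1 - l) * dist p (c a) + l * dist p (c b) := by
  have hcc := IsLine.continuous hc
  refine convex_of_midpoint (f := fun t => dist p (c t)) (by fun_prop) ?_ a b l h0 h1
  intro a b
  have h := mid_line hcat hc p a b
  have t1 := dist_triangle p (c a) (c b)
  have t2 := dist_triangle p (c b) (c a)
  rw [dist_comm (c b), hc a b] at t2
  rw [hc] at t1
  have e := sq_abs (a - b)
  have hA := dist_nonneg (x := p) (y := c a)
  have hB := dist_nonneg (x := p) (y := c b)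
  refine le_of_sq_le_sq_aux (by positivity) ?_
  have : (dist p (c a) - dist p (c b)) ^ 2 ≤ |a - b| ^ 2 := by
    apply sq_le_sq'
    · linarith
    · linarith
  nlinarith

theorem thales (hcat : IsCAT0 X) {c c' : ℝ → X} (hc : IsLine c) (hc' : IsLine c')
    (h : c 0 = c' 0) (a b l : ℝ) (h0 : 0 ≤ l) (h1 : l ≤ 1) :
    dist (c (l * a)) (c' (l * b)) ≤ l * dist (c a) (c' b) := by
  have e1 := cn_line hcat hc' (c (l * a)) 0 b l h0 h1
  have e2 := cn_line hcat hc (c' b) 0 a l h0 h1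
  rw [← h] at e1
  rw [h] at e2
  simp only [mul_zero, zero_add, sub_zero] at e1 e2
  rw [hc (l * a) 0, sq_abs] at e1
  rw [hc' b 0, sq_abs, dist_comm (c' b), dist_comm (c' b)] at e2
  refine le_of_sq_le_sq_aux (by positivity) ?_
  nlinarith [mul_le_mul_of_nonneg_left e2 h0]

/-- two lines with the same origin through the same point agree in between -/
theorem line_unique (hcat : IsCAT0 X) {c c' : ℝ → X} (hc : IsLine c) (hc' : IsLine c')
    (h : c 0 = c' 0) {a : ℝ} (ha : c a = c' a) {t : ℝ} (h0 : 0 ≤ t) (h1 : t ≤ a) : c t = c' t := by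
  rcases h0.eq_or_lt with rfl | h0
  · exact h
  have hap : 0 < a := h0.trans_le h1
  have := thales hcat hc hc' h a a (t / a) (by positivity) ((div_le_one hap).2 h1)
  rw [ha, dist_self, mul_zero, div_mul_cancel₀ _ hap.ne'] at this
  exact dist_le_zero.1 this

end CatGeo


namespace CatGeo

variable {X : Type*} [MetricSpace X]

theorem h_mono (hcat : IsCAT0 X) {c c' : ℝ → X} (hc : IsLine c) (hc' : IsLine c')
    (h : c 0 = c' 0) {t s : ℝ} (ht : 0 < t) (hts : t ≤ s) :
    dist (c t) (c' t) / t ≤ dist (c s) (c' s) / s := by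
  have hs : 0 < s := ht.trans_le hts
  have := thales hcat hc hc' h s s (t / s) (by positivity) ((div_le_one hs).2 hts)
  rw [div_mul_cancel₀ _ hs.ne'] at this
  rw [div_le_div_iff₀ ht hs]
  calc dist (c t) (c' t) * s ≤ (t / s * dist (c s) (c' s)) * s := by gcongr
    _ = dist (c s) (c' s) * t := by field_simp

theorem ev_almost_const {f : ℝ → ℝ} (h0 : ∀ t, 0 < t → 0 ≤ f t)
    (hm : ∀ t s, 0 < t → t ≤ s → f t ≤ f s) {η : ℝ} (hη : 0 < η) :
    ∀ᶠ s in nhdsWithin (0:ℝ) (Ioi 0), ∀ t, 0 < t → t ≤ s → f s ≤ f t + η := by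
  have hbdd : BddBelow (f '' Ioi 0) := ⟨0, by rintro _ ⟨t, ht, rfl⟩; exact h0 t ht⟩
  obtain ⟨_, ⟨s0, hs0, rfl⟩, hlt⟩ := exists_lt_of_csInf_lt
    (⟨f 1, 1, by simp, rfl⟩ : (f '' Ioi 0).Nonempty) (lt_add_of_pos_right (sInf (f '' Ioi 0)) hη)
  have : Ioc (0:ℝ) s0 ∈ nhdsWithin (0:ℝ) (Ioi 0) := Ioc_mem_nhdsGT hs0
  filter_upwards [this] with s hs t ht hts
  have h1 := hm s s0 hs.1 hs.2
  have h2 := csInf_le hbdd (⟨t, ht, rfl⟩ : f t ∈ f '' Ioi 0)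
  linarith

theorem unif_almost_const [ProperSpace X] (hcat : IsCAT0 X) (x : X) {η : ℝ} (hη : 0 < η) :
    ∃ s : ℝ, 0 < s ∧ s ≤ 1 ∧ ∀ c c' : ℝ → X, IsLine c → IsLine c' → c 0 = x → c' 0 = x →
      ∀ t, 0 < t → t ≤ s → dist (c s) (c' s) / s ≤ dist (c t) (c' t) / t + η := by
  set E : Set X := {w | ∃ c : ℝ → X, IsLine c ∧ c 0 = x ∧ c 1 = w} with hE
  have hEt : TotallyBounded E := by
    refine (isCompact_closedBall x 1).totallyBounded.subset ?_
    rintro w ⟨c, hc, h0, rfl⟩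
    rw [Metric.mem_closedBall, ← h0, hc]; norm_num
  obtain ⟨T, hTE, hTf, hT⟩ := Metric.finite_approx_of_totallyBounded hEt (η / 12) (by positivity)
  have hch : ∀ w, ∃ c : ℝ → X, w ∈ E → IsLine c ∧ c 0 = x ∧ c 1 = w := by
    intro w
    by_cases hw : w ∈ E
    · obtain ⟨c, hc⟩ := hw; exact ⟨c, fun _ => hc⟩
    · exact ⟨fun _ => x, fun h => absurd h hw⟩
  choose l hl using hch
  have hev : ∀ᶠ s in nhdsWithin (0:ℝ) (Ioi 0), ∀ w ∈ T, ∀ u ∈ T, ∀ t, 0 < t → t ≤ s →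
      dist (l w s) (l u s) / s ≤ dist (l w t) (l u t) / t + η / 3 := by
    rw [Filter.eventually_all_finite hTf]
    intro w hw
    rw [Filter.eventually_all_finite hTf]
    intro u hu
    obtain ⟨a1, a2, a3⟩ := hl w (hTE hw)
    obtain ⟨b1, b2, b3⟩ := hl u (hTE hu)
    exact ev_almost_const (f := fun t => dist (l w t) (l u t) / t)
      (fun t ht => by positivity)
      (fun t s ht hts => h_mono hcat a1 b1 (a2.trans b2.symm) ht hts) (by positivity)
  have h1 : Ioc (0:ℝ) 1 ∈ nhdsWithin (0:ℝ) (Ioi 0) := Ioc_mem_nhdsGT one_pos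
  obtain ⟨s, hs, hs1⟩ := (hev.and h1).exists
  refine ⟨s, hs1.1, hs1.2, ?_⟩
  intro c c' hc hc' h0 h0' t ht hts
  have near : ∀ c : ℝ → X, IsLine c → c 0 = x → ∃ w ∈ T, ∀ t, 0 < t → t ≤ 1 →
      dist (c t) (l w t) / t ≤ η / 12 := by
    intro c hc h0
    have := hT (⟨c, hc, h0, rfl⟩ : c 1 ∈ E)
    simp only [mem_iUnion, Metric.mem_ball] at this
    obtain ⟨w, hw, hd⟩ := this
    obtain ⟨a1, a2, a3⟩ := hl w (hTE hw)
    refine ⟨w, hw, fun t ht ht1 => ?_⟩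
    have := h_mono hcat hc a1 (h0.trans a2.symm) ht ht1
    rw [a3] at this
    linarith
  obtain ⟨w, hw, nw⟩ := near c hc h0
  obtain ⟨u, hu, nu⟩ := near c' hc' h0'
  have k := hs w hw u hu t ht hts
  have s0 := hs1.1
  have q1 : dist (c s) (c' s) / s ≤ dist (c s) (l w s) / s + dist (l w s) (l u s) / s
      + dist (c' s) (l u s) / s := by
    rw [← add_div, ← add_div]
    gcongr
    have t1 := dist_triangle (c s) (l w s) (c' s)
    have t2 := dist_triangle (l w s) (l u s) (c' s)
    rw [dist_comm (c' s)]
    linarith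
  have q2 : dist (l w t) (l u t) / t ≤ dist (c t) (l w t) / t + dist (c t) (c' t) / t
      + dist (c' t) (l u t) / t := by
    rw [← add_div, ← add_div]
    gcongr
    have t1 := dist_triangle (l w t) (c t) (l u t)
    have t2 := dist_triangle (c t) (c' t) (l u t)
    rw [dist_comm (c t) (l w t)]
    linarith
  have n1 := nw s hs1.1 hs1.2
  have n2 := nw t ht (hts.trans hs1.2)
  have n3 := nu s hs1.1 hs1.2
  have n4 := nu t ht (hts.trans hs1.2)
  linarith

/-- first variation upper bound -/
theorem slope_bound (hcat : IsCAT0 X) {c : ℝ → X} (hc : IsLine c) (p : X) {τ ℓ : ℝ}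
    (h0 : 0 ≤ τ) (h1 : τ ≤ ℓ) (hℓ : 0 < ℓ) :
    (dist p (c τ) - dist p (c 0)) * (2 * dist p (c 0) * ℓ) ≤
      τ * (dist p (c ℓ) ^ 2 - dist p (c 0) ^ 2 - ℓ ^ 2 + τ * ℓ) := by
  have h := cn_line hcat hc p 0 ℓ (τ / ℓ) (by positivity) ((div_le_one hℓ).2 h1)
  simp only [mul_zero, zero_add, sub_zero, div_mul_cancel₀ _ hℓ.ne'] at h
  have h2 : dist p (c τ) ^ 2 * ℓ ≤ ℓ * dist p (c 0) ^ 2 - τ * dist p (c 0) ^ 2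
      + τ * dist p (c ℓ) ^ 2 - τ * (ℓ - τ) * ℓ := by
    calc _ ≤ _ := mul_le_mul_of_nonneg_right h hℓ.le
      _ = _ := by field_simp
  nlinarith [mul_nonneg hℓ.le (sq_nonneg (dist p (c τ) - dist p (c 0)))]

theorem num_aux {a N W P u v δ : ℝ} (hP : 0 < P) (hW : 0 < W)
    (h : a * W ≤ N) (hN : N ≤ P * u) (hu : |u| ≤ 2) (hδ : 0 ≤ δ)
    (h1 : P * (1 - δ) ≤ W) (h2 : W ≤ P * (1 + δ)) (hv : u + 2 * δ ≤ v * (1 - δ))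
    (hv2 : u + 2 * δ ≤ v) :
    a ≤ v := by
  have hu' := abs_le.1 hu
  by_contra hc
  push Not at hc
  have k1 : v * W < P * u := lt_of_lt_of_le ((mul_lt_mul_iff_left₀ hW).2 hc) (h.trans hN)
  rcases le_total 0 v with h0 | h0
  · have : v * (P * (1 - δ)) ≤ v * W := by gcongr
    have : P * (u + 2 * δ) ≤ P * (v * (1 - δ)) := by gcongr
    nlinarith
  · have : v * (P * (1 + δ)) ≤ v * W := mul_le_mul_of_nonpos_left h2 h0
    have : P * (u + 2 * δ) ≤ P * v := by gcongr
    have : 0 < P * (- v * δ - 2 * δ) := by nlinarith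
    have : 0 < - v * δ - 2 * δ := pos_of_mul_pos_right this hP.le
    nlinarith

end CatGeo


namespace CatGeo

variable {X : Type*} [MetricSpace X]

theorem num_ax {δ s t τ ℓ A hT x' : ℝ} (hδ0 : 0 < δ) (hδ1 : δ ≤ 1 / 200) (hs0 : 0 < s)
    (hy0 : 0 < t) (hτ0 : 0 < τ) (hℓp : 0 < ℓ) (hA0 : 0 < A) (hdt : δ * t ≤ 1 / 200 * t)
    (hds : δ * s ≤ 1 / 200 * s) (hyr : t ≤ δ * s)
    (hτℓ2 : τ * ℓ ≤ 2 * (δ * t) * ((1 + 2 * δ) * s)) (A1 : A ≤ (1 + δ) * t)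
    (A2 : (1 - δ) * t ≤ A) (ℓ1 : ℓ ≤ (1 + 2 * δ) * s) (ℓ2 : (1 - 2 * δ) * s ≤ ℓ)
    (hTT : hT ^ 2 ≤ 4)
    (hym : s ^ 2 + t ^ 2 - 2 * s * t * (1 - hT ^ 2 / 2) ≤
      ℓ ^ 2 + 2 * (δ * t) * ℓ + (δ * t) ^ 2)
    (sx : (x' - A) * (2 * A * ℓ) ≤ τ * (s ^ 2 - A ^ 2 - ℓ ^ 2 + τ * ℓ)) :
    (x' - A) / τ ≤ 1 - hT ^ 2 / 2 + 44 * δ := by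
  have hTT0 := sq_nonneg hT
  refine num_aux (N := s ^ 2 - A ^ 2 - ℓ ^ 2 + τ * ℓ) (W := 2 * A * ℓ) (P := 2 * t * s)
    (u := 1 - hT ^ 2 / 2 + 4 * δ) (δ := 5 * δ) (by positivity) (by positivity) ?_ ?_ ?_
    (by positivity) ?_ ?_ ?_ ?_
  · rw [div_mul_eq_mul_div, div_le_iff₀ hτ0]; linarith
  · have a1 : ((1 - δ) * t) ^ 2 ≤ A ^ 2 := pow_le_pow_left₀ (by linarith) A2 2
    have a2 : 2 * (δ * t) * ℓ ≤ 2 * (δ * t) * ((1 + 2 * δ) * s) := by gcongr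
    have a3 : 0 < δ * t * s := by positivity
    have a4 : (δ * t * s) * δ ≤ (δ * t * s) * (1 / 200) := by gcongr
    have a5 : δ * t * t ≤ δ * t * s := by gcongr; linarith
    have a6 : 0 < t * t := by positivity
    have a7 : δ * (t * t) ≤ 1 / 200 * (t * t) := by gcongr
    linarith [(show (1 - δ) ^ 2 * t ^ 2 = t ^ 2 - 2 * δ * t * t + δ ^ 2 * t ^ 2 by ring)]
  · rw [abs_le]; constructor <;> linarith
  · have h1 : (1 - δ) * t * ((1 - 2 * δ) * s) ≤ A * ℓ := by
      apply mul_le_mul A2 ℓ2 (by linarith) hA0.le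
    have h2 : 0 < δ * t * s := by positivity
    have h3 : 0 < (δ * t * s) * δ := by positivity
    linarith
  · have h1 : A * ℓ ≤ (1 + δ) * t * ((1 + 2 * δ) * s) := by
      apply mul_le_mul A1 ℓ1 hℓp.le (by positivity)
    have h2 : (δ * t * s) * δ ≤ (δ * t * s) * (1 / 200) := by gcongr
    have h3 : 0 < δ * t * s := by positivity
    linarith
  · have h1 : (1 - hT ^ 2 / 2 + 44 * δ) * δ ≤ 2 * δ := by gcongr; linarith
    linarith
  · linarith

theorem num_aq {δ s t τ ℓ B hS x' : ℝ} (hδ0 : 0 < δ) (hδ1 : δ ≤ 1 / 200) (hs0 : 0 < s)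
    (hy0 : 0 < t) (hτ0 : 0 < τ) (hℓp : 0 < ℓ) (hB0 : 0 < B) (hdt : δ * t ≤ 1 / 200 * t)
    (hds : δ * s ≤ 1 / 200 * s) (hyr : t ≤ δ * s)
    (hτℓ2 : τ * ℓ ≤ 2 * (δ * t) * ((1 + 2 * δ) * s)) (B1 : B ≤ (1 + 2 * δ) * s)
    (B2 : (1 - 2 * δ) * s ≤ B) (ℓ1 : ℓ ≤ (1 + 2 * δ) * s) (ℓ2 : (1 - 2 * δ) * s ≤ ℓ)
    (hSS : hS ^ 2 ≤ 4)
    (sx : (x' - B) * (2 * B * ℓ) ≤ τ * ((hS * s) ^ 2 - B ^ 2 - ℓ ^ 2 + τ * ℓ)) :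
    (x' - B) / τ ≤ hS ^ 2 / 2 - 1 + 45 * δ := by
  have hSS0 := sq_nonneg hS
  refine num_aux (N := (hS * s) ^ 2 - B ^ 2 - ℓ ^ 2 + τ * ℓ) (W := 2 * B * ℓ) (P := 2 * s * s)
    (u := hS ^ 2 / 2 - 1 + 5 * δ) (δ := 5 * δ) (by positivity) (by positivity) ?_ ?_ ?_
    (by positivity) ?_ ?_ ?_ ?_
  · rw [div_mul_eq_mul_div, div_le_iff₀ hτ0]; linarith
  · have a1 : ((1 - 2 * δ) * s) ^ 2 ≤ B ^ 2 := pow_le_pow_left₀ (by linarith) B2 2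
    have a2 : ((1 - 2 * δ) * s) ^ 2 ≤ ℓ ^ 2 := pow_le_pow_left₀ (by linarith) ℓ2 2
    have a3 : 2 * (δ * t) * ((1 + 2 * δ) * s) ≤ 2 * (δ * (1 / 200 * s)) * (2 * s) := by
      gcongr
      · linarith
      · linarith
    have a4 : 0 < δ * s * s := by positivity
    have a5 : 0 < δ * δ * s * s := by positivity
    linarith
  · rw [abs_le]; constructor <;> linarith
  · have h1 : (1 - 2 * δ) * s * ((1 - 2 * δ) * s) ≤ B * ℓ := by
      apply mul_le_mul B2 ℓ2 (by linarith) hB0.le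
    have h2 : 0 < δ * s * s := by positivity
    have h3 : 0 < δ * δ * s * s := by positivity
    linarith
  · have h1 : B * ℓ ≤ (1 + 2 * δ) * s * ((1 + 2 * δ) * s) := by
      apply mul_le_mul B1 ℓ1 hℓp.le (by positivity)
    have h2 : (δ * s * s) * δ ≤ (δ * s * s) * (1 / 200) := by gcongr
    have h3 : 0 < δ * s * s := by positivity
    linarith
  · have h1 : (hS ^ 2 / 2 - 1 + 45 * δ) * δ ≤ 2 * δ := by gcongr; linarith
    linarith
  · linarith

set_option maxHeartbeats 1000000 in
theorem key_strainer [ProperSpace X] (hcat : IsCAT0 X) (hgc : GeodesicallyComplete X)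
    (x : X) {ε : ℝ} (hε : 0 < ε) :
    ∃ r > 0, ∀ y, 0 < dist x y → dist x y < r → ∃ q : X, ∃ ρ > 0,
      ∀ z ∈ Metric.ball y ρ, ∀ z' ∈ Metric.ball y ρ,
        (dist x z' + dist q z') - (dist x z + dist q z) ≤ ε * dist z z' := by
  obtain ⟨s, hs0, hs1, hs⟩ := unif_almost_const hcat x (η := ε / 4) (by positivity)
  obtain ⟨δ, hδ0, hδ1, hδ2⟩ : ∃ δ : ℝ, 0 < δ ∧ δ ≤ 1 / 200 ∧ δ ≤ ε / 200 :=
    ⟨min (1/200) (ε / 200), by positivity, min_le_left _ _, min_le_right _ _⟩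
  refine ⟨δ * s, by positivity, fun y hy0 hyr => ?_⟩
  obtain ⟨c, hc, c0, cy⟩ := exists_line hcat hgc x y
  set t := dist x y with ht
  have hdt : δ * t ≤ 1 / 200 * t := by gcongr
  have hds : δ * s ≤ 1 / 200 * s := by gcongr
  have hdt0 : 0 < δ * t := by positivity
  have hds0 : 0 < δ * s := by positivity
  have hts : t ≤ s := by linarith
  refine ⟨c s, δ * t, by positivity, fun z hz z' hz' => ?_⟩
  rw [Metric.mem_ball] at hz hz'
  rcases eq_or_ne z z' with rfl | hne
  · simp
  obtain ⟨γ, hγ, γ0, γz⟩ := exists_line hcat hgc z z'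
  set τ := dist z z' with hτ
  have hτ0 : 0 < τ := dist_pos.2 hne
  have hτ2 : τ ≤ 2 * (δ * t) := by
    have := dist_triangle_right z z' y
    linarith
  -- A
  set A := dist x z with hA
  have A1 : A ≤ (1 + δ) * t := by
    have := dist_triangle_right x z y; linarith
  have A2 : (1 - δ) * t ≤ A := by
    have := dist_triangle x z y; linarith
  have hA0 : 0 < A := lt_of_lt_of_le (by linarith) A2
  have hAs : A ≤ 2 * δ * s := by linarith
  -- the point m
  obtain ⟨ℓ, ⟨hℓ0, _⟩, hm⟩ : ∃ ℓ ∈ Icc (0:ℝ) (2 * s), dist x (γ ℓ) = s := by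
    have hγc := IsLine.continuous hγ
    refine intermediate_value_Icc (f := fun ℓ => dist x (γ ℓ)) (by positivity)
      (by fun_prop) ⟨?_, ?_⟩
    · show dist x (γ 0) ≤ s
      rw [γ0]; linarith
    · show s ≤ dist x (γ (2 * s))
      have h1 := dist_triangle_left (γ 0) (γ (2 * s)) x
      rw [hγ, γ0, zero_sub, abs_neg, abs_of_pos (by positivity)] at h1
      linarith
  set m := γ ℓ with hmdef
  have hzm : dist z m = ℓ := by rw [← γ0, hγ, zero_sub, abs_neg, abs_of_nonneg hℓ0]
  have ℓ1 : ℓ ≤ (1 + 2 * δ) * s := by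
    have := dist_triangle_left z m x
    linarith
  have ℓ2 : (1 - 2 * δ) * s ≤ ℓ := by
    have := dist_triangle x z m
    linarith
  have hℓp : 0 < ℓ := lt_of_lt_of_le (by linarith) ℓ2
  have hτℓ : τ ≤ ℓ := by linarith
  have hτℓ2 : τ * ℓ ≤ 2 * (δ * t) * ((1 + 2 * δ) * s) := by gcongr
  -- comparison line to m
  obtain ⟨c', hc', c0', cm'⟩ := exists_line hcat hgc x m
  rw [hm] at cm'
  have hst := hs c c' hc hc' c0 c0' t hy0 hts
  have hmono := h_mono hcat hc hc' (c0.trans c0'.symm) hy0 hts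
  set hS := dist (c s) (c' s) / s with hhS
  set hT := dist (c t) (c' t) / t with hhT
  have hT0 : 0 ≤ hT := by positivity
  have hS2 : hS ≤ 2 := by
    rw [hhS, div_le_iff₀ hs0]
    have h1 := dist_triangle (c s) (c 0) (c' s)
    rw [hc, c0, ← c0', hc', sub_zero, zero_sub, abs_neg, abs_of_pos hs0] at h1
    linarith
  have eS : dist (c s) m = hS * s := by rw [hhS, cm', div_mul_cancel₀ _ hs0.ne']
  have eT : dist y (c' t) = hT * t := by rw [hhT, cy, div_mul_cancel₀ _ hy0.ne']
  -- lower bound on dist y m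
  have hym : s ^ 2 + t ^ 2 - 2 * s * t * (1 - hT ^ 2 / 2) ≤ dist y m ^ 2 := by
    have h := cn_line hcat hc' y 0 s (t / s) (by positivity) ((div_le_one hs0).2 hts)
    simp only [mul_zero, zero_add, sub_zero, div_mul_cancel₀ _ hs0.ne'] at h
    rw [eT, c0', cm', dist_comm y x, ← ht] at h
    have h2 : (hT * t) ^ 2 * s ≤ s * t ^ 2 - t * t ^ 2 + t * dist y m ^ 2 - t * (s - t) * s := by
      calc _ ≤ _ := mul_le_mul_of_nonneg_right h hs0.le
        _ = _ := by field_simp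
    have : t * (s ^ 2 + t ^ 2 - 2 * s * t * (1 - hT ^ 2 / 2)) ≤ t * dist y m ^ 2 := by
      nlinarith
    exact le_of_mul_le_mul_left this hy0
  have hyl : dist y m ≤ ℓ + δ * t := by
    have := dist_triangle y z m
    rw [dist_comm y z] at this; linarith
  have hyl2 : dist y m ^ 2 ≤ ℓ ^ 2 + 2 * (δ * t) * ℓ + (δ * t) ^ 2 := by
    have := pow_le_pow_left₀ dist_nonneg hyl 2
    linarith [this, (show (ℓ + δ * t) ^ 2 = ℓ ^ 2 + 2 * (δ * t) * ℓ + (δ * t) ^ 2 by ring)]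
  -- B
  set B := dist (c s) z with hB
  have dsy : dist (c s) y = s - t := by rw [← cy, hc, abs_of_nonneg (by linarith)]
  have B1 : B ≤ (1 + 2 * δ) * s := by
    have := dist_triangle_right (c s) z y
    linarith
  have B2 : (1 - 2 * δ) * s ≤ B := by
    have := dist_triangle (c s) z y
    linarith
  have hB0 : 0 < B := lt_of_lt_of_le (by linarith) B2
  have sx := slope_bound hcat hγ x hτ0.le hτℓ hℓp
  have sq := slope_bound hcat hγ (c s) hτ0.le hτℓ hℓp
  rw [γ0, γz, ← hmdef] at sx sq
  rw [hm, ← hA] at sx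
  rw [eS, ← hB] at sq
  have hhT2 : hT ≤ 2 := hmono.trans hS2
  have hTT : hT ^ 2 ≤ 4 := by
    have := pow_le_pow_left₀ hT0 hhT2 2
    linarith
  have hSS : hS ^ 2 ≤ 4 := by
    have := pow_le_pow_left₀ (hT0.trans hmono) hS2 2
    linarith
  have hTT0 := sq_nonneg hT
  have hSS0 := sq_nonneg hS
  have ax := num_ax hδ0 hδ1 hs0 hy0 hτ0 hℓp hA0 hdt hds hyr.le hτℓ2 A1 A2 ℓ1 ℓ2 hTT
    (hym.trans hyl2) sx
  have aq := num_aq hδ0 hδ1 hs0 hy0 hτ0 hℓp hB0 hdt hds hyr.le hτℓ2 B1 B2 ℓ1 ℓ2 hSS sq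
  rw [div_le_iff₀ hτ0] at ax aq
  have hfin : hS ^ 2 / 2 - hT ^ 2 / 2 ≤ ε / 2 := by
    have h1 : (hS - hT) * (hS + hT) ≤ (ε / 4) * 4 := by
      apply mul_le_mul <;> linarith
    linarith [h1, (show (hS - hT) * (hS + hT) = hS ^ 2 - hT ^ 2 by ring)]
  have : (1 - hT ^ 2 / 2 + 44 * δ) + (hS ^ 2 / 2 - 1 + 45 * δ) ≤ ε := by linarith
  have := mul_le_mul_of_nonneg_right this hτ0.le
  linarith

end CatGeo


namespace CatGeo

variable {X : Type*} [MetricSpace X]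

/-- A strainer of size `k` with precision `ε` on the open set `U`. -/
def Str (ε : ℝ) (k : ℕ) (p q : ℕ → X) (U : Set X) : Prop :=
  IsOpen U ∧ ∀ i < k, p i ∉ U ∧
    (∀ z ∈ U, ∀ z' ∈ U,
      |(dist (p i) z' + dist (q i) z') - (dist (p i) z + dist (q i) z)| ≤ ε * dist z z') ∧
    ∀ j < i, ∀ w ∈ U, |dist (p j) (p i) - dist (p j) w| ≤ ε * dist (p i) w ∧
      |dist (q j) (p i) - dist (q j) w| ≤ 2 * ε * dist (p i) w

theorem Str.move (hcat : IsCAT0 X) {ε : ℝ} {k : ℕ} {p q : ℕ → X} {U : Set X}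
    (h : Str ε k p q U) {i j : ℕ} (hi : i < k) (hj : j < i) {c : ℝ → X} (hc : IsLine c)
    (c0 : c 0 = p i) {a b : ℝ} (hb : 0 < b) (hba : b ≤ a) (ha' : c a ∈ U) (hb' : c b ∈ U) :
    |dist (p j) (c a) - dist (p j) (c b)| ≤ 3 * ε * (a - b) := by
  have ha : 0 < a := hb.trans_le hba
  obtain ⟨_, _, h3⟩ := h.2 i hi
  obtain ⟨_, h2, _⟩ := h.2 j (hj.trans hi)
  obtain ⟨f1, g1⟩ := h3 j hj _ ha'
  have hd : dist (p i) (c a) = a := by rw [← c0, hc, zero_sub, abs_neg, abs_of_pos ha]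
  rw [hd] at f1 g1
  have s1 := h2 _ ha' _ hb'
  rw [hc, abs_of_nonneg (sub_nonneg.2 hba)] at s1
  have cf := convex_dist hcat hc (p j) 0 a (b / a) (by positivity) ((div_le_one ha).2 hba)
  have cg := convex_dist hcat hc (q j) 0 a (b / a) (by positivity) ((div_le_one ha).2 hba)
  simp only [mul_zero, zero_add, div_mul_cancel₀ _ ha.ne', c0] at cf cg
  have l0 : 0 ≤ 1 - b / a := sub_nonneg.2 ((div_le_one ha).2 hba)
  have e : (1 - b / a) * a = a - b := by field_simp
  rw [abs_le] at f1 g1 s1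
  have f2 : (1 - b / a) * (dist (p j) (p i) - dist (p j) (c a)) ≤ ε * (a - b) := by
    rw [← e]
    calc _ ≤ (1 - b / a) * (ε * a) := by gcongr; exact f1.2
      _ = _ := by ring
  have g2 : (1 - b / a) * (dist (q j) (p i) - dist (q j) (c a)) ≤ 2 * ε * (a - b) := by
    rw [← e]
    calc _ ≤ (1 - b / a) * (2 * ε * a) := by gcongr; exact g1.2
      _ = _ := by ring
  have hεab : 0 ≤ ε * (a - b) := by linarith
  rw [abs_le]
  constructor <;> linarith

theorem Str.extend [ProperSpace X] (hcat : IsCAT0 X) (hgc : GeodesicallyComplete X)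
    {ε : ℝ} (hε : 0 < ε) (x : X) :
    ∃ r > 0, ∀ {k : ℕ} {p q : ℕ → X} {U : Set X}, Str ε k p q U → x ∈ U →
      ∀ y ∈ U, dist x y < r → 0 < dist x y →
        (∀ j < k, |dist (p j) x - dist (p j) y| ≤ ε / 2 * dist x y) →
        ∃ p' q' : ℕ → X, ∃ V, y ∈ V ∧ Str ε (k + 1) p' q' V := by
  obtain ⟨r, hr, H⟩ := key_strainer hcat hgc x hε
  refine ⟨r, hr, ?_⟩
  intro k p q U h hx y hy hyr hy0 hF
  obtain ⟨q0, ρ, hρ, hq⟩ := H y hy0 hyr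
  set V : Set X := U ∩ Metric.ball y ρ ∩ {x}ᶜ ∩
    {w | ∀ j ∈ Finset.range k, |dist (p j) x - dist (p j) w| < ε * dist x w} with hV
  have hVo : IsOpen V := by
    refine ((h.1.inter Metric.isOpen_ball).inter isOpen_compl_singleton).inter ?_
    have : {w | ∀ j ∈ Finset.range k, |dist (p j) x - dist (p j) w| < ε * dist x w} =
        ⋂ j ∈ Finset.range k, {w | |dist (p j) x - dist (p j) w| < ε * dist x w} := by
      ext w; simp
    rw [this]
    refine isOpen_biInter_finset fun j _ => isOpen_lt (by fun_prop) (by fun_prop)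
  have hyV : y ∈ V := by
    refine ⟨⟨⟨hy, Metric.mem_ball_self hρ⟩, ?_⟩, ?_⟩
    · simp only [mem_compl_iff, mem_singleton_iff]
      rintro rfl
      simp at hy0
    · intro j hj
      have := hF j (Finset.mem_range.1 hj)
      nlinarith
  refine ⟨Function.update p k x, Function.update q k q0, V, hyV, hVo, ?_⟩
  intro i hi
  rcases (Nat.lt_succ_iff_lt_or_eq.1 hi) with hi | rfl
  · rw [Function.update_of_ne hi.ne, Function.update_of_ne hi.ne]
    obtain ⟨h1, h2, h3⟩ := h.2 i hi
    refine ⟨fun hh => h1 hh.1.1.1, fun z hz z' hz' => h2 z hz.1.1.1 z' hz'.1.1.1, ?_⟩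
    intro j hj w hw
    rw [Function.update_of_ne (hj.trans hi).ne, Function.update_of_ne (hj.trans hi).ne]
    exact h3 j hj w hw.1.1.1
  · rw [Function.update_self, Function.update_self]
    refine ⟨fun hh => hh.1.2 rfl, fun z hz z' hz' => ?_, ?_⟩
    · have a1 := hq z hz.1.1.2 z' hz'.1.1.2
      have a2 := hq z' hz'.1.1.2 z hz.1.1.2
      rw [dist_comm z' z] at a2
      rw [abs_le]; constructor <;> linarith
    · intro j hj w hw
      rw [Function.update_of_ne hj.ne, Function.update_of_ne hj.ne]
      have b1 := (hw.2 j (Finset.mem_range.2 hj)).le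
      have b2 := (h.2 j hj).2.1 x hx w hw.1.1.1
      refine ⟨b1, ?_⟩
      rw [abs_le] at *
      constructor <;> linarith

theorem Str.sep [ProperSpace X] (hcat : IsCAT0 X) (hgc : GeodesicallyComplete X)
    {ε : ℝ} (hε : 0 < ε) (hε1 : ε ≤ 1 / 6) {k : ℕ} {p q : ℕ → X} {U : Set X}
    (h : Str ε k p q U) {w : X} (hw : w ∈ U) :
    ∃ P : ℕ → X, (∀ i < k, dist w (P i) ≤ 1) ∧ ∀ i < k, ∀ j < i, 1 / 2 ≤ dist (P i) (P j) := by
  have hl : ∀ i, ∃ c : ℝ → X, IsLine c ∧ c 0 = w ∧ c (dist w (p i)) = p i := fun i =>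
    exists_line hcat hgc w (p i)
  choose c hc c0 cp using hl
  refine ⟨fun i => c i 1, fun i hi => ?_, fun i hi j hj => ?_⟩
  · show dist w (c i 1) ≤ 1
    rw [← c0 i, hc]; norm_num
  · show 1 / 2 ≤ dist (c i 1) (c j 1)
    obtain ⟨ρ, hρ, hball⟩ := Metric.isOpen_iff.1 h.1 w hw
    have hpi : 0 < dist w (p i) := dist_pos.2 (fun e => (h.2 i hi).1 (e ▸ hw))
    have hpj : 0 < dist w (p j) := dist_pos.2 (fun e => (h.2 j (hj.trans hi)).1 (e ▸ hw))
    obtain ⟨s, hs0, hs⟩ : ∃ s, 0 < s ∧ s < min (min ρ 1) (min (dist w (p i)) (dist w (p j))) :=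
      exists_between (by positivity)
    simp only [lt_min_iff] at hs
    obtain ⟨⟨hsρ, hs1⟩, hsi, hsj⟩ := hs
    have th := thales hcat (hc i) (hc j) ((c0 i).trans (c0 j).symm) 1 1 s hs0.le hs1.le
    rw [mul_one] at th
    have hin : c i s ∈ U := hball (by
      rw [Metric.mem_ball, ← c0 i, hc, sub_zero, abs_of_pos hs0]; exact hsρ)
    have mv := Str.move hcat h hi hj (IsLine.rev (hc i) (dist w (p i))) (by simp [cp])
      (a := dist w (p i)) (b := dist w (p i) - s) (by linarith) (by linarith)
      (by simpa [c0] using hw) (by simpa using hin)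
    simp only [sub_self, c0, sub_sub_cancel] at mv
    have dj : dist (p j) (c j s) = dist w (p j) - s := by
      rw [← cp j, hc, cp j, abs_of_nonneg (by linarith)]
    have tri := dist_triangle_right (p j) (c i s) (c j s)
    rw [dist_comm (p j) w, abs_le] at mv
    have : s * (1 - 3 * ε) ≤ s * dist (c i 1) (c j 1) := by linarith
    have := le_of_mul_le_mul_left this hs0
    linarith

theorem packing [ProperSpace X] {D : ℝ} (x0 : X) (hcoc : ∀ x : X, ∃ g : X ≃ᵢ X, dist x0 (g x) ≤ D) :
    ∃ N : ℕ, ∀ (k : ℕ) (w : X) (P : ℕ → X), (∀ i < k, dist w (P i) ≤ 1) →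
      (∀ i < k, ∀ j < i, 1 / 2 ≤ dist (P i) (P j)) → k ≤ N := by
  obtain ⟨T, -, hTf, hT⟩ := Metric.finite_approx_of_totallyBounded
    (isCompact_closedBall x0 (D + 1)).totallyBounded (1 / 4) (by norm_num)
  refine ⟨hTf.toFinset.card, fun k w P h1 h2 => ?_⟩
  obtain ⟨g, hg⟩ := hcoc w
  have hn : ∀ i, ∃ t, i < k → t ∈ T ∧ dist (g (P i)) t < 1 / 4 := by
    intro i
    by_cases hi : i < k
    · have : g (P i) ∈ Metric.closedBall x0 (D + 1) := by
        rw [Metric.mem_closedBall, dist_comm]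
        have := dist_triangle x0 (g w) (g (P i))
        rw [g.dist_eq] at this
        linarith [h1 i hi]
      have := hT this
      simp only [mem_iUnion, Metric.mem_ball] at this
      obtain ⟨t, ht, hd⟩ := this
      exact ⟨t, fun _ => ⟨ht, hd⟩⟩
    · exact ⟨x0, fun h => absurd h hi⟩
  choose f hf using hn
  have key : ∀ i < k, ∀ j < i, f i ≠ f j := by
    intro i hi j hj e
    have a1 := (hf i hi).2
    have a2 := (hf j (hj.trans hi)).2
    rw [← e] at a2
    have := dist_triangle_right (g (P i)) (g (P j)) (f i)
    rw [g.dist_eq] at this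
    linarith [h2 i hi j hj]
  have := Finset.card_le_card_of_injOn (s := Finset.range k) (t := hTf.toFinset) f
    (fun i hi => by simpa using (hf i (by simpa using hi)).1) (by
      intro i hi j hj e
      simp only [Finset.coe_range, mem_Iio] at hi hj
      rcases lt_trichotomy i j with h | h | h
      · exact absurd e.symm (key j hj i h)
      · exact h
      · exact absurd e (key i hi j h))
  simpa using this

end CatGeo


namespace CatGeo

variable {X : Type*} [MetricSpace X]

theorem weight_sum (ε : ℝ) (i n : ℕ) :
    (n ≤ i → ∑ j ∈ Finset.range n, (1/4 : ℝ) ^ j *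
      (if j < i then 3 * ε else if j = i then -1 else 1) ≤ 4 * ε * (1 - (1/4 : ℝ) ^ n)) ∧
    (0 ≤ ε → i < n → ∑ j ∈ Finset.range n, (1/4 : ℝ) ^ j *
      (if j < i then 3 * ε else if j = i then -1 else 1) ≤
        4 * ε - (1/4 : ℝ) ^ i + 4 / 3 * ((1/4 : ℝ) ^ (i + 1) - (1/4 : ℝ) ^ n)) := by
  induction n with
  | zero => simp
  | succ n ih =>
    constructor
    · intro h
      rw [Finset.sum_range_succ, if_pos (by omega), pow_succ]
      linarith [ih.1 (by omega)]
    · intro hε h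
      rw [Finset.sum_range_succ, if_neg (by omega)]
      rcases (Nat.lt_succ_iff_lt_or_eq.1 h) with h | rfl
      · rw [if_neg (by omega), pow_succ _ n]
        linarith [ih.2 hε h]
      · rw [if_pos rfl]
        have := ih.1 le_rfl
        have : 0 ≤ ε * (1/4 : ℝ) ^ i := by positivity
        linarith

theorem Str.surj [ProperSpace X] (hcat : IsCAT0 X) (hgc : GeodesicallyComplete X)
    {ε : ℝ} (hε : 0 < ε) {k : ℕ} (hεk : 16 * ε ≤ (1/4 : ℝ) ^ k) {p q : ℕ → X} {U : Set X}
    (h : Str ε k p q U) {z : X} {ρ : ℝ} (hρ : 0 < ρ) (hball : Metric.ball z ρ ⊆ U)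
    (v : ℕ → ℝ)
    (hv : ∑ j ∈ Finset.range k, (1/4 : ℝ) ^ j * |dist (p j) z - v j| < (1/4 : ℝ) ^ k / 8 * ρ) :
    ∃ y ∈ Metric.ball z ρ, ∀ i < k, dist (p i) y = v i := by
  set φ : X → ℝ := fun y => (∑ j ∈ Finset.range k, (1/4 : ℝ) ^ j * |dist (p j) y - v j|)
    + (1/4 : ℝ) ^ k / 8 * dist z y with hφ
  obtain ⟨y, hyb, hmin⟩ := (isCompact_closedBall z ρ).exists_isMinOn (f := φ)
    ⟨z, Metric.mem_closedBall_self hρ.le⟩ (by fun_prop)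
  have hmin' : ∀ y' ∈ Metric.closedBall z ρ, φ y ≤ φ y' := hmin
  have hyρ : dist z y < ρ := by
    have h1 := hmin' z (Metric.mem_closedBall_self hρ.le)
    simp only [hφ, dist_self, mul_zero, add_zero] at h1
    have h2 : 0 ≤ ∑ j ∈ Finset.range k, (1/4 : ℝ) ^ j * |dist (p j) y - v j| :=
      Finset.sum_nonneg fun j _ => by positivity
    have h3 : (1/4 : ℝ) ^ k / 8 * dist z y < (1/4 : ℝ) ^ k / 8 * ρ := by linarith
    exact lt_of_mul_lt_mul_left h3 (by positivity)
  refine ⟨y, by rwa [Metric.mem_ball, dist_comm], fun i hi => ?_⟩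
  by_contra hne
  have hyU : y ∈ U := hball (by rwa [Metric.mem_ball, dist_comm])
  obtain ⟨c, hc, c0, cL⟩ := exists_line hcat hgc (p i) y
  set L := dist (p i) y with hL
  have hL0 : 0 < L := dist_pos.2 (fun e => (h.2 i hi).1 (e ▸ hyU))
  have hne' : 0 < |L - v i| := abs_pos.2 (sub_ne_zero.2 hne)
  obtain ⟨η, hη0, hη⟩ : ∃ η, 0 < η ∧ η < min (min L |L - v i|) (ρ - dist z y) :=
    exists_between (lt_min (lt_min hL0 hne') (sub_pos.2 hyρ))
  simp only [lt_min_iff] at hη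
  obtain ⟨⟨ηL, ηv⟩, ηρ⟩ := hη
  -- the new point
  obtain ⟨b, hb0, hbL, hbv⟩ : ∃ b, 0 < b ∧ |L - b| = η ∧ |b - v i| = |L - v i| - η := by
    rcases le_total (v i) L with hh | hh
    · rw [abs_of_nonneg (sub_nonneg.2 hh)] at ηv ⊢
      refine ⟨L - η, by linarith, ?_, ?_⟩
      · rw [abs_of_nonneg] <;> linarith
      · rw [abs_of_nonneg] <;> linarith
    · rw [abs_of_nonpos (sub_nonpos.2 hh)] at ηv ⊢
      refine ⟨L + η, by linarith, ?_, ?_⟩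
      · rw [abs_of_nonpos] <;> linarith
      · rw [abs_of_nonpos] <;> linarith
  have hyb' : dist y (c b) = η := by rw [← cL, hc, hbL]
  have hzb : dist z (c b) ≤ dist z y + η := by rw [← hyb']; exact dist_triangle _ _ _
  have hbU : c b ∈ U := hball (by rw [Metric.mem_ball, dist_comm]; linarith)
  have hm := hmin' (c b) (by rw [Metric.mem_closedBall, dist_comm]; linarith)
  have each : ∀ j ∈ Finset.range k, (1/4 : ℝ) ^ j * |dist (p j) (c b) - v j| ≤
      (1/4 : ℝ) ^ j * |dist (p j) y - v j| +
      ((1/4 : ℝ) ^ j * (if j < i then 3 * ε else if j = i then -1 else 1)) * η := by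
    intro j _
    have gen : |dist (p j) (c b) - v j| ≤ |dist (p j) y - v j| + |dist (p j) (c b) - dist (p j) y| := by
      have := abs_add_le (dist (p j) y - v j) (dist (p j) (c b) - dist (p j) y)
      rwa [show dist (p j) y - v j + (dist (p j) (c b) - dist (p j) y) = dist (p j) (c b) - v j by
        ring] at this
    have : |dist (p j) (c b) - v j| ≤ |dist (p j) y - v j| +
      (if j < i then 3 * ε else if j = i then -1 else 1) * η := by
      split_ifs with h1 h2
      · refine gen.trans (add_le_add le_rfl ?_)
        rcases le_total b L with hh | hh
        · have := Str.move hcat h hi h1 hc c0 hb0 hh (cL.symm ▸ hyU) hbU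
          rw [abs_sub_comm, cL, ← abs_of_nonneg (sub_nonneg.2 hh), hbL] at this
          exact this
        · have := Str.move hcat h hi h1 hc c0 hL0 hh hbU (cL.symm ▸ hyU)
          rw [cL, ← abs_of_nonneg (sub_nonneg.2 hh), abs_sub_comm b L, hbL] at this
          exact this
      · subst h2
        have : dist (p j) (c b) = b := by rw [← c0, hc, zero_sub, abs_neg, abs_of_pos hb0]
        rw [this, hbv, ← hL]; linarith
      · refine gen.trans (add_le_add le_rfl ?_)
        rw [one_mul, ← hyb', dist_comm y, dist_comm (p j), dist_comm (p j)]
        exact abs_dist_sub_le _ _ _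
    calc _ ≤ (1/4 : ℝ) ^ j * (|dist (p j) y - v j| +
      (if j < i then 3 * ε else if j = i then -1 else 1) * η) := by gcongr
      _ = _ := by ring
  have hsum := Finset.sum_le_sum each
  rw [Finset.sum_add_distrib, ← Finset.sum_mul] at hsum
  have hw := (weight_sum ε i k).2 hε.le hi
  have hik : (1/4 : ℝ) ^ k ≤ (1/4 : ℝ) ^ (i + 1) :=
    pow_le_pow_of_le_one (by norm_num) (by norm_num) hi
  rw [pow_succ] at hik hw
  have hkp : 0 < (1/4 : ℝ) ^ k := by positivity
  have h5 := mul_le_mul_of_nonneg_left hzb (by positivity : 0 ≤ (1/4 : ℝ) ^ k / 8)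
  simp only [hφ] at hm
  set S := ∑ j ∈ Finset.range k, (1/4 : ℝ) ^ j *
      (if j < i then 3 * ε else if j = i then -1 else 1) with hS
  have hneg : S + (1/4 : ℝ) ^ k / 8 < 0 := by linarith
  have := mul_neg_of_neg_of_pos hneg hη0
  linarith

theorem dimH_le_of_local_antilip {Y : Type*} [MetricSpace Y] [SecondCountableTopology Y]
    {k : ℕ} (E : Set Y) (F : Y → Fin k → ℝ) {a : ℝ} (ha : 0 < a)
    (h : ∀ x ∈ E, ∃ r > 0, ∀ y ∈ E, dist x y < r → a * dist x y ≤ dist (F x) (F y)) :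
    dimH E ≤ k := by
  set A : ℕ → Set Y := fun m => {x ∈ E | ∀ y ∈ E, dist x y < 1 / ((m : ℝ) + 1) →
    a * dist x y ≤ dist (F x) (F y)} with hA
  have hEA : E ⊆ ⋃ m, A m := by
    intro x hx
    obtain ⟨r, hr, H⟩ := h x hx
    obtain ⟨m, hm⟩ := exists_nat_one_div_lt hr
    exact mem_iUnion.2 ⟨m, hx, fun y hy hd => H y hy (hd.trans hm)⟩
  refine (dimH_mono hEA).trans ?_
  rw [dimH_iUnion]
  refine iSup_le fun m => ?_
  by_contra hcon
  push Not at hcon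
  obtain ⟨x, hx, hloc⟩ := exists_mem_nhdsWithin_lt_dimH_of_lt_dimH hcon
  have hm : (0:ℝ) < 1 / ((m : ℝ) + 1) / 2 := by positivity
  have := hloc (A m ∩ Metric.ball x (1 / ((m : ℝ) + 1) / 2))
    (inter_mem_nhdsWithin _ (Metric.ball_mem_nhds x hm))
  refine absurd this (not_lt.2 ?_)
  set B := A m ∩ Metric.ball x (1 / ((m : ℝ) + 1) / 2) with hB
  have hanti : AntilipschitzWith (Real.toNNReal a⁻¹) (fun z : B => F z) := by
    refine AntilipschitzWith.of_le_mul_dist fun u v => ?_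
    rw [Real.coe_toNNReal _ (by positivity), ← div_eq_inv_mul, le_div_iff₀ ha, mul_comm]
    refine u.2.1.2 v v.2.1.1 ?_
    have h1 := u.2.2
    have h2 := v.2.2
    rw [Metric.mem_ball] at h1 h2
    have := dist_triangle_right (u : Y) v x
    linarith
  have h1 := hanti.le_dimH_image univ
  have h2 : dimH (univ : Set B) = dimH B := by
    have := (isometry_subtype_coe (s := B)).dimH_image univ
    rw [image_univ, Subtype.range_coe] at this
    exact this.symm
  rw [← h2]
  refine h1.trans ((dimH_mono (subset_univ _)).trans ?_)
  rw [Real.dimH_univ_pi_fin]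

end CatGeo


namespace CatGeo

variable {X : Type*} [MetricSpace X]

theorem strain_main [ProperSpace X] [Nonempty X] (hcat : IsCAT0 X) (hgc : GeodesicallyComplete X)
    {D : ℝ} (hcoc : ∀ x y : X, ∃ g : X ≃ᵢ X, dist y (g x) ≤ D) :
    ∃ n : ℕ, dimH (univ : Set X) ≤ n ∧ ∃ V : Set X, IsOpen V ∧ V.Nonempty ∧
      ∀ V' ⊆ V, IsOpen V' → V'.Nonempty →
        ∃ e : ↥(Icc (0 : Fin n → ℝ) 1) → X, Continuous e ∧ Function.Injective e ∧
          ∀ u, e u ∈ V' := by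
  classical
  obtain ⟨x0⟩ := ‹Nonempty X›
  obtain ⟨N, hN⟩ := packing x0 (fun x => hcoc x x0)
  obtain ⟨ε, hε0, hε1, hεN⟩ : ∃ ε : ℝ, 0 < ε ∧ ε ≤ 1 / 6 ∧ 16 * ε = (1/4 : ℝ) ^ N := by
    refine ⟨(1/4 : ℝ) ^ N / 16, by positivity, ?_, by ring⟩
    have : (1/4 : ℝ) ^ N ≤ 1 := pow_le_one₀ (by norm_num) (by norm_num)
    linarith
  set S : ℕ → X → Prop := fun k z => ∃ p q : ℕ → X, ∃ U, z ∈ U ∧ Str ε k p q U with hS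
  have hSN : ∀ k z, S k z → k ≤ N := by
    rintro k z ⟨p, q, U, hz, h⟩
    obtain ⟨P, h1, h2⟩ := Str.sep hcat hgc hε0 hε1 h hz
    exact hN k z P h1 h2
  have hS0 : ∀ z, S 0 z := fun z =>
    ⟨fun _ => x0, fun _ => x0, univ, mem_univ _, isOpen_univ, fun i hi => absurd hi (by omega)⟩
  have hanti : ∀ {k p q U}, Str ε k p q U → ∀ x ∈ U, ∃ r > 0, ∀ y ∈ U, ¬ S (k + 1) y →
      dist x y < r → ε / 2 * dist x y ≤
        dist (fun j : Fin k => dist (p j) x) (fun j : Fin k => dist (p j) y) := by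
    intro k p q U h x hx
    obtain ⟨r, hr, H⟩ := Str.extend hcat hgc hε0 x
    refine ⟨r, hr, fun y hy hyS hd => ?_⟩
    by_contra hcon
    push Not at hcon
    have hpos : 0 < dist x y := by
      by_contra h0
      have : dist x y = 0 := le_antisymm (not_lt.1 h0) dist_nonneg
      rw [this, mul_zero] at hcon
      exact absurd hcon (not_lt.2 dist_nonneg)
    refine hyS (H h hx y hy hd hpos fun j hj => ?_)
    have := dist_le_pi_dist (fun j : Fin k => dist (p j) x) (fun j : Fin k => dist (p j) y) ⟨j, hj⟩
    rw [Real.dist_eq] at this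
    exact this.trans hcon.le
  set n := Nat.findGreatest (fun k => ∃ z, S k z) N with hn
  have hle : ∀ k z, S k z → k ≤ n := fun k z h => Nat.le_findGreatest (hSN k z h) ⟨z, h⟩
  obtain ⟨z0, p, q, U, hz0, hstr⟩ : ∃ z, S n z :=
    Nat.findGreatest_spec (P := fun k => ∃ z, S k z) (Nat.zero_le N) ⟨x0, hS0 x0⟩
  have hnN : n ≤ N := Nat.findGreatest_le N
  refine ⟨n, ?_, ?_⟩
  · set E : ℕ → Set X := fun k => {z | S k z ∧ ¬ S (k + 1) z} with hE
    have hcov : (univ : Set X) ⊆ ⋃ k, (if k ≤ n then E k else ∅) := by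
      intro z _
      set k := Nat.findGreatest (fun k => S k z) N with hk
      have h1 : S k z := Nat.findGreatest_spec (P := fun k => S k z) (Nat.zero_le N) (hS0 z)
      have h2 : ¬ S (k + 1) z := fun h => by
        have := Nat.le_findGreatest (P := fun k => S k z) (hSN _ _ h) h
        omega
      refine mem_iUnion.2 ⟨k, ?_⟩
      rw [if_pos (hle k z h1)]
      exact ⟨h1, h2⟩
    refine (dimH_mono hcov).trans ?_
    rw [dimH_iUnion]
    refine iSup_le fun k => ?_
    split_ifs with hk
    swap
    · simp
    refine le_trans ?_ (Nat.cast_le.2 hk : (k : ℝ≥0∞) ≤ n)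
    by_contra hcon
    push Not at hcon
    obtain ⟨x, hx, hloc⟩ := exists_mem_nhdsWithin_lt_dimH_of_lt_dimH hcon
    obtain ⟨⟨p', q', U', hxU, hst⟩, _⟩ := id hx
    refine absurd (hloc (E k ∩ U') (inter_mem_nhdsWithin _ (hst.1.mem_nhds hxU))) (not_lt.2 ?_)
    refine dimH_le_of_local_antilip _ (fun z => fun j : Fin k => dist (p' j) z) (half_pos hε0) ?_
    intro y hy
    obtain ⟨r, hr, H⟩ := hanti hst y hy.2
    exact ⟨r, hr, fun y' hy' hd => H y' hy'.2 hy'.1.2 hd⟩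
  · set F : X → Fin n → ℝ := fun z j => dist (p j) z with hF
    have hFc : Continuous F := by fun_prop
    set A : ℕ → Set X := fun m => Uᶜ ∪ {x | ∀ y ∈ U, dist x y < 1 / ((m : ℝ) + 1) →
      ε / 2 * dist x y ≤ dist (F x) (F y)} with hA
    have hAc : ∀ m, IsClosed (A m) := by
      intro m
      refine hstr.1.isClosed_compl.union ?_
      have : {x | ∀ y ∈ U, dist x y < 1 / ((m : ℝ) + 1) →
          ε / 2 * dist x y ≤ dist (F x) (F y)} =
          ⋂ y ∈ U, ({x | 1 / ((m : ℝ) + 1) ≤ dist x y} ∪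
            {x | ε / 2 * dist x y ≤ dist (F x) (F y)}) := by
        ext x
        simp only [mem_ofPred_eq, mem_iInter, mem_union]
        refine forall₂_congr fun y _ => ?_
        rw [imp_iff_not_or, not_lt]
      rw [this]
      exact isClosed_biInter fun y _ => (isClosed_le (by fun_prop) (by fun_prop)).union
        (isClosed_le (by fun_prop) (by fun_prop))
    have hAu : ⋃ m, A m = univ := by
      refine eq_univ_of_forall fun x => ?_
      by_cases hx : x ∈ U
      · obtain ⟨r, hr, H⟩ := hanti hstr x hx
        obtain ⟨m, hm⟩ := exists_nat_one_div_lt hr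
        refine mem_iUnion.2 ⟨m, Or.inr fun y hy hd => H y hy (fun h => ?_) (hd.trans hm)⟩
        have := hle _ _ h
        omega
      · exact mem_iUnion.2 ⟨0, Or.inl hx⟩
    obtain ⟨x, hxU, hxI⟩ := (dense_iUnion_interior_of_closed hAc hAu).inter_open_nonempty U hstr.1
      ⟨z0, hz0⟩
    obtain ⟨m, hm⟩ := mem_iUnion.1 hxI
    have hm0 : (0:ℝ) < 1 / ((m : ℝ) + 1) / 2 := by positivity
    refine ⟨U ∩ interior (A m) ∩ Metric.ball x (1 / ((m : ℝ) + 1) / 2),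
      (hstr.1.inter isOpen_interior).inter Metric.isOpen_ball,
      ⟨x, ⟨hxU, hm⟩, Metric.mem_ball_self hm0⟩, ?_⟩
    intro V' hV' hV'o ⟨z, hz⟩
    have hal : ∀ u ∈ V', ∀ v ∈ V', ε / 2 * dist u v ≤ dist (F u) (F v) := by
      intro u hu v hv
      have hu' := hV' hu
      have hv' := hV' hv
      rcases interior_subset hu'.1.2 with h | h
      · exact absurd hu'.1.1 h
      · refine h v hv'.1.1 ?_
        have h1 := hu'.2
        have h2 := hv'.2
        rw [Metric.mem_ball] at h1 h2
        have := dist_triangle_right u v x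
        linarith
    obtain ⟨ρ, hρ, hball⟩ := Metric.isOpen_iff.1 hV'o z hz
    set β : ℝ := (1/4 : ℝ) ^ n / 8 * ρ / (n + 1) with hβ
    have hβ0 : 0 < β := by positivity
    have hsur : ∀ u : ↥(Icc (0 : Fin n → ℝ) 1), ∃ y ∈ V', ∀ j : Fin n,
        dist (p j) y = dist (p j) z + β * u.1 j := by
      intro u
      obtain ⟨y, hy, H⟩ := Str.surj hcat hgc hε0
        (hεN.le.trans (pow_le_pow_of_le_one (by norm_num) (by norm_num) hnN)) hstr hρ
        (fun w hw => (hV' (hball hw)).1.1)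
        (fun j => dist (p j) z + β * (if h : j < n then u.1 ⟨j, h⟩ else 0)) (by
          have hb : ∀ j ∈ Finset.range n, (1/4 : ℝ) ^ j * |dist (p j) z -
              (dist (p j) z + β * (if h : j < n then u.1 ⟨j, h⟩ else 0))| ≤ β := by
            intro j hj
            rw [dif_pos (Finset.mem_range.1 hj)]
            have h0 := u.2.1 ⟨j, Finset.mem_range.1 hj⟩
            have h1 := u.2.2 ⟨j, Finset.mem_range.1 hj⟩
            simp only [Pi.zero_apply, Pi.one_apply] at h0 h1
            rw [sub_add_cancel_left, abs_neg, abs_of_nonneg (by positivity)]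
            have : (1/4 : ℝ) ^ j ≤ 1 := pow_le_one₀ (by norm_num) (by norm_num)
            calc _ ≤ 1 * (β * 1) := by gcongr
              _ = β := by ring
          refine (Finset.sum_le_sum hb).trans_lt ?_
          rw [Finset.sum_const, Finset.card_range, nsmul_eq_mul, hβ]
          have : 0 < (1/4 : ℝ) ^ n / 8 * ρ := by positivity
          rw [mul_div_assoc', div_lt_iff₀ (by positivity)]
          nlinarith)
      refine ⟨y, hball hy, fun j => ?_⟩
      rw [H j j.2, dif_pos j.2]
    choose e heV he using hsur
    refine ⟨e, ?_, ?_, heV⟩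
    · have : LipschitzWith (Real.toNNReal (2 / ε * β)) e := by
        refine LipschitzWith.of_dist_le_mul fun u v => ?_
        rw [Real.coe_toNNReal _ (by positivity)]
        have h1 := hal _ (heV u) _ (heV v)
        have h2 : dist (F (e u)) (F (e v)) ≤ β * dist u v := by
          rw [dist_pi_le_iff (by positivity)]
          intro j
          simp only [hF, he]
          rw [Real.dist_eq, add_sub_add_left_eq_sub, ← mul_sub, abs_mul, abs_of_pos hβ0]
          gcongr
          exact dist_le_pi_dist u.1 v.1 j
        have h3 := mul_le_mul_of_nonneg_left (h1.trans h2) (by positivity : 0 ≤ 2 / ε)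
        calc dist (e u) (e v) = 2 / ε * (ε / 2 * dist (e u) (e v)) := by field_simp
          _ ≤ _ := h3
          _ = _ := by ring
      exact this.continuous
    · intro u v huv
      apply Subtype.ext
      funext j
      have h1 := he u j
      rw [huv, he v j] at h1
      have := mul_left_cancel₀ hβ0.ne' (add_left_cancel h1)
      exact this.symm

end CatGeo


/-! ## Szpilrajn's inequality: topological dimension is at most Hausdorff dimension -/

section Szpilrajn
open MeasureTheory MeasureTheory.Measure Filter Topology

theorem eilenberg_ae {Y : Type*} [MetricSpace Y] [MeasurableSpace Y] [BorelSpace Y] (n : ℕ)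
    (N : Set Y) (hN : μH[(n : ℝ) + 1] N = 0) (x : Y) :
    ∀ᵐ r : ℝ, μH[(n : ℝ)] (N ∩ Metric.sphere x r) = 0 := by
  have hcov : ∀ k : ℕ, ∃ t : ℕ → Set Y, N ⊆ ⋃ i, t i ∧ (∀ i, Metric.ediam (t i) ≤ ((k : ℝ≥0∞) + 1)⁻¹) ∧
      ∑' i, ⨆ _ : (t i).Nonempty, Metric.ediam (t i) ^ ((n : ℝ) + 1) < (2⁻¹ : ℝ≥0∞) ^ k := by
    intro k
    rw [hausdorffMeasure_apply] at hN
    have h1 : ⨅ (t : ℕ → Set Y) (_ : N ⊆ ⋃ n, t n) (_ : ∀ i, Metric.ediam (t i) ≤ ((k : ℝ≥0∞) + 1)⁻¹),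
          ∑' i, ⨆ _ : (t i).Nonempty, Metric.ediam (t i) ^ ((n : ℝ) + 1) ≤ 0 := by
      rw [← hN]
      exact le_iSup₂_of_le ((k : ℝ≥0∞) + 1)⁻¹ (by simp) le_rfl
    have h2 : (0 : ℝ≥0∞) < (2⁻¹ : ℝ≥0∞) ^ k := by
      apply ENNReal.pow_pos; simp
    have h3 := lt_of_le_of_lt h1 h2
    simp only [iInf_lt_iff] at h3
    obtain ⟨t, h4, h5, h6⟩ := h3
    exact ⟨t, h4, h5, h6⟩
  choose t ht1 ht2 ht3 using hcov
  let f : Y → ℝ := fun y => dist y x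
  have hf : LipschitzWith 1 f := LipschitzWith.dist_left x
  let I : ℕ → ℕ → Set ℝ := fun k i => toMeasurable volume (f '' t k i)
  let g : ℕ → ℝ → ℝ≥0∞ := fun k r => ∑' i, (I k i).indicator (fun _ => Metric.ediam (t k i) ^ (n : ℝ)) r
  have hgm : ∀ k, Measurable (g k) := fun k =>
    Measurable.ennreal_tsum fun i => measurable_const.indicator (measurableSet_toMeasurable _ _)
  have hgi : ∀ k, ∫⁻ r, g k r ≤ (2⁻¹ : ℝ≥0∞) ^ k := by
    intro k
    refine le_trans ?_ (ht3 k).le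
    simp only [g]
    rw [lintegral_tsum (fun i =>
      (measurable_const.indicator (measurableSet_toMeasurable _ _)).aemeasurable)]
    refine ENNReal.tsum_le_tsum fun i => ?_
    rw [lintegral_indicator (measurableSet_toMeasurable _ _), setLIntegral_const, measure_toMeasurable]
    rcases (t k i).eq_empty_or_nonempty with he | hne
    · simp [he]
    · have h1 : volume (f '' t k i) ≤ Metric.ediam (t k i) := by
        refine (Real.volume_le_diam _).trans ?_
        have := hf.ediam_image_le (t k i)
        simpa using this
      simp only [hne, iSup_pos]
      calc _ ≤ Metric.ediam (t k i) ^ (n : ℝ) * Metric.ediam (t k i) := by gcongr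
        _ = _ := by
          rw [ENNReal.rpow_natCast, ← pow_succ]
          rw [← ENNReal.rpow_natCast]; push_cast; rfl
  have hsum : ∫⁻ r, ∑' k, g k r ≠ ∞ := by
    rw [lintegral_tsum (fun k => (hgm k).aemeasurable)]
    refine ne_top_of_le_ne_top ?_ (ENNReal.tsum_le_tsum hgi)
    rw [ENNReal.tsum_geometric]
    simp
  have hae := ae_lt_top' (Measurable.ennreal_tsum hgm).aemeasurable hsum
  filter_upwards [hae] with r hr
  have hlim : Tendsto (fun k => g k r) atTop (𝓝 0) :=
    ENNReal.tendsto_atTop_zero_of_tsum_ne_top hr.ne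
  have hr0 : Tendsto (fun k : ℕ => ((k : ℝ≥0∞) + 1)⁻¹) atTop (𝓝 0) := by
    have := ENNReal.tendsto_inv_nat_nhds_zero.comp (tendsto_add_atTop_nat 1)
    refine this.congr fun k => ?_
    simp
  have := hausdorffMeasure_le_liminf_tsum (n : ℝ) (N ∩ Metric.sphere x r) (l := atTop)
    (fun k : ℕ => ((k : ℝ≥0∞) + 1)⁻¹) hr0
    (ι := fun k => {i : ℕ // (t k i ∩ Metric.sphere x r).Nonempty})
    (fun k i => t k i) (Eventually.of_forall fun k i => ht2 k i)
    (Eventually.of_forall fun k => by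
      rintro y ⟨hy, hys⟩
      obtain ⟨i, hi⟩ := mem_iUnion.1 (ht1 k hy)
      exact mem_iUnion.2 ⟨⟨i, ⟨y, hi, hys⟩⟩, hi⟩)
  refine le_antisymm (this.trans ?_) (zero_le)
  rw [← hlim.liminf_eq]
  refine liminf_le_liminf (Eventually.of_forall fun k => ?_)
  change ∑' i : {i : ℕ // (t k i ∩ Metric.sphere x r).Nonempty}, Metric.ediam (t k i) ^ (n:ℝ) ≤ g k r
  have := tsum_subtype {i : ℕ | (t k i ∩ Metric.sphere x r).Nonempty} (fun i => Metric.ediam (t k i) ^ (n:ℝ))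
  refine le_of_eq_of_le this ?_
  refine ENNReal.tsum_le_tsum fun i => ?_
  by_cases hi : (t k i ∩ Metric.sphere x r).Nonempty
  · obtain ⟨y, hy, hys⟩ := hi
    have : r ∈ I k i := subset_toMeasurable _ _ ⟨y, hy, hys⟩
    rw [indicator_of_mem this]
    exact indicator_le_self' (fun _ _ => zero_le) i
  · rw [indicator_of_notMem (by exact hi)]
    exact zero_le

theorem szp_aux {Y : Type*} [MetricSpace Y] [SecondCountableTopology Y]
    [MeasurableSpace Y] [BorelSpace Y] {ι : Type*} [Nonempty ι]
    (U : ι → Set Y) (hU : ∀ i, IsOpen (U i)) (hc : ⋃ i, U i = univ) :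
    ∀ (n : ℕ) (N : Set Y), μH[(n : ℝ)] N = 0 → ∃ V : Fin n → ℕ → Set Y,
      (∀ a i, IsOpen (V a i)) ∧ (∀ a, Pairwise (fun i j => Disjoint (V a i) (V a j))) ∧
      (∀ a i, ∃ j, V a i ⊆ U j) ∧ N ⊆ ⋃ a, ⋃ i, V a i := by
  intro n
  induction n with
  | zero =>
    intro N hN
    have : N = ∅ := by
      by_contra h
      obtain ⟨y, hy⟩ := nonempty_iff_ne_empty.2 h
      have h1 : μH[((0:ℕ) : ℝ)] {y} ≤ μH[((0:ℕ) : ℝ)] N := measure_mono (by simpa using hy)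
      rw [hN, Nat.cast_zero, hausdorffMeasure_zero_singleton] at h1
      simp at h1
    exact ⟨fun a => a.elim0, fun a => a.elim0, fun a => a.elim0, fun a => a.elim0, by simp [this]⟩
  | succ n ih =>
    intro N hN
    push_cast at hN
    have hr : ∀ x : Y, ∃ r : ℝ, 0 < r ∧ (∃ j, Metric.ball x r ⊆ U j) ∧
        μH[(n : ℝ)] (N ∩ Metric.sphere x r) = 0 := by
      intro x
      have hx : x ∈ ⋃ i, U i := by rw [hc]; trivial
      obtain ⟨j, hj⟩ := mem_iUnion.1 hx
      obtain ⟨ε, hε, hb⟩ := Metric.isOpen_iff.1 (hU j) x hj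
      have hae := eilenberg_ae n N hN x
      obtain ⟨r, hr1, hr2⟩ : ∃ r ∈ Ioo 0 ε, μH[(n : ℝ)] (N ∩ Metric.sphere x r) = 0 := by
        by_contra hcon
        push Not at hcon
        have : volume (Ioo 0 ε) ≤ 0 := by
          refine (measure_mono ?_).trans (le_of_eq (ae_iff.1 hae))
          intro r hr; exact hcon r hr
        simp at this
        linarith
      exact ⟨r, hr1.1, ⟨j, (Metric.ball_subset_ball hr1.2.le).trans hb⟩, hr2⟩
    choose r hr0 hrU hrN using hr
    rcases N.eq_empty_or_nonempty with rfl | hne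
    · exact ⟨fun _ _ => ∅, by simp, by intro a i j _; simp, fun a i => ⟨Classical.arbitrary ι, by simp⟩, by simp⟩
    obtain ⟨T, hTN, hTc, hT⟩ := TopologicalSpace.countable_cover_nhdsWithin
      (f := fun x => Metric.ball x (r x)) (s := N)
      (fun x _ => mem_nhdsWithin_of_mem_nhds (Metric.ball_mem_nhds x (hr0 x)))
    have hTne : T.Nonempty := by
      obtain ⟨y, hy⟩ := hne
      obtain ⟨x, hx, _⟩ := mem_iUnion₂.1 (hT hy)
      exact ⟨x, hx⟩
    obtain ⟨c, hcT⟩ := hTc.exists_eq_range hTne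
    let O : ℕ → Set Y := fun i => Metric.ball (c i) (r (c i)) \ ⋃ j ∈ Finset.range i, Metric.closedBall (c j) (r (c j))
    let N' : Set Y := ⋃ i, N ∩ Metric.sphere (c i) (r (c i))
    have hN' : μH[(n : ℝ)] N' = 0 := measure_iUnion_null fun i => hrN (c i)
    obtain ⟨V, hV1, hV2, hV3, hV4⟩ := ih N' hN'
    refine ⟨Fin.cons O V, ?_, ?_, ?_, ?_⟩
    · intro a i
      refine Fin.cases ?_ (fun a => ?_) a
      · exact Metric.isOpen_ball.sdiff (isClosed_biUnion_finset fun j _ => Metric.isClosed_closedBall)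
      · exact hV1 a i
    · intro a
      refine Fin.cases ?_ (fun a => ?_) a
      · have key : ∀ i j, i < j → Disjoint (O i) (O j) := by
          intro i j hij
          rw [Set.disjoint_left]
          intro y hy1 hy2
          apply hy2.2
          exact mem_iUnion₂.2 ⟨i, Finset.mem_range.2 hij, Metric.ball_subset_closedBall hy1.1⟩
        intro i j hij
        rcases lt_or_gt_of_ne hij with h | h
        · exact key i j h
        · exact (key j i h).symm
      · exact hV2 a
    · intro a i
      refine Fin.cases ?_ (fun a => ?_) a
      · obtain ⟨j, hj⟩ := hrU (c i)
        exact ⟨j, diff_subset.trans hj⟩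
      · exact hV3 a i
    · intro y hy
      by_cases hyN : y ∈ N'
      · obtain ⟨a, ha⟩ := mem_iUnion.1 (hV4 hyN)
        exact mem_iUnion.2 ⟨a.succ, ha⟩
      · have hex : ∃ i, y ∈ Metric.ball (c i) (r (c i)) := by
          obtain ⟨x, hx, hyx⟩ := mem_iUnion₂.1 (hT hy)
          rw [hcT] at hx
          obtain ⟨i, rfl⟩ := hx
          exact ⟨i, hyx⟩
        classical
        refine mem_iUnion.2 ⟨0, mem_iUnion.2 ⟨Nat.find hex, Nat.find_spec hex, ?_⟩⟩
        intro hmem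
        obtain ⟨j, hj, hyj⟩ := mem_iUnion₂.1 hmem
        have h1 := Nat.find_min hex (Finset.mem_range.1 hj)
        rw [Metric.mem_ball] at h1
        rw [Metric.mem_closedBall] at hyj
        exact hyN (mem_iUnion.2 ⟨j, hy, le_antisymm hyj (not_lt.1 h1)⟩)

theorem dimLE_of_dimH {Y : Type*} [MetricSpace Y] [SecondCountableTopology Y] (n : ℕ)
    (h : dimH (univ : Set Y) < (n : ℝ≥0∞) + 1) : DimLE Y n := by
  borelize Y
  intro ι U hU hc
  rcases isEmpty_or_nonempty Y with hY | hY
  · exact ⟨Empty, fun e => e.elim, fun e => e.elim, Subsingleton.elim _ _, fun e => e.elim,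
      fun x => (hY.false x).elim⟩
  have hι : Nonempty ι := by
    obtain ⟨y⟩ := hY
    have : y ∈ ⋃ i, U i := by rw [hc]; trivial
    obtain ⟨i, _⟩ := mem_iUnion.1 this
    exact ⟨i⟩
  have h0 : μH[((n + 1 : ℕ) : ℝ)] (univ : Set Y) = 0 := by
    have := hausdorffMeasure_of_dimH_lt (s := (univ : Set Y)) (d := ((n+1 : ℕ) : NNReal)) (by
      push_cast; exact h)
    simpa using this
  obtain ⟨V, hV1, hV2, hV3, hV4⟩ := szp_aux U hU hc (n+1) univ h0
  refine ⟨Fin (n+1) × ℕ, fun p => V p.1 p.2, fun p => hV1 _ _, ?_, fun p => hV3 _ _, ?_⟩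
  · rw [eq_univ_iff_forall]
    intro y
    obtain ⟨a, ha⟩ := mem_iUnion.1 (hV4 (mem_univ y))
    obtain ⟨i, hi⟩ := mem_iUnion.1 ha
    exact mem_iUnion.2 ⟨(a, i), hi⟩
  · intro x
    have hinj : InjOn Prod.fst {j : Fin (n+1) × ℕ | x ∈ V j.1 j.2} := by
      rintro ⟨a, i⟩ hi ⟨b, j⟩ hj hab
      simp only at hab
      subst hab
      by_contra hne
      have : i ≠ j := fun h => hne (by rw [h])
      exact Set.disjoint_left.1 (hV2 a this) hi hj
    have hfin : {j : Fin (n+1) × ℕ | x ∈ V j.1 j.2}.Finite :=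
      Set.Finite.of_finite_image (Set.toFinite _) hinj
    refine ⟨hfin, ?_⟩
    rw [← ncard_image_of_injOn hinj]
    refine (ncard_le_card _).trans ?_
    simp

end Szpilrajn


/-! ## A cubical Sperner lemma (Kuhn triangulation), mod 2 -/

namespace KS


/-- The vertices of the Kuhn simplex with base `z` and order `τ`. -/
def vert {n : ℕ} (z : Fin n → ℕ) (τ : Equiv.Perm (Fin n)) (k : ℕ) : Fin n → ℕ :=
  fun i => z i + if (τ i : ℕ) < k then 1 else 0

/-- Facet vertices: the coordinate with `τ i = 0` is frozen. -/
def fac {n : ℕ} (z : Fin (n+1) → ℕ) (τ : Equiv.Perm (Fin (n+1))) (k : ℕ) : Fin (n+1) → ℕ :=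
  fun i => z i + if τ i ≠ 0 ∧ (τ i : ℕ) ≤ k then 1 else 0

/-- rainbow indicator -/
noncomputable def rb {n : ℕ} (c : Fin (n+1) → ℕ) : ZMod 2 :=
  if Finset.univ.image c = Finset.range (n+1) then 1 else 0

/-- door indicator -/
noncomputable def dr {n : ℕ} (c : Fin (n+1) → ℕ) : ZMod 2 :=
  if Finset.univ.image c = Finset.Icc 1 (n+1) then 1 else 0

lemma local_count {n : ℕ} (c : Fin (n+2) → ℕ) (hc : ∀ k, c k ≤ n+1) :
    rb c = ∑ k : Fin (n+2), dr (fun j => c (k.succAbove j)) := by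
  classical
  have key : ∀ k : Fin (n+2), Finset.univ.image (fun j => c (k.succAbove j)) = Finset.Icc 1 (n+1) →
      Function.Injective (fun j : Fin (n+1) => c (k.succAbove j)) := by
    intro k hk
    have : (Finset.univ.image (fun j => c (k.succAbove j))).card = (Finset.univ : Finset (Fin (n+1))).card := by
      rw [hk]; simp
    have := Finset.card_image_iff.1 this
    intro a b hab
    exact this (by simp) (by simp) hab
  by_cases hex : ∃ k : Fin (n+2), Finset.univ.image (fun j => c (k.succAbove j)) = Finset.Icc 1 (n+1)
  · obtain ⟨k, hk⟩ := hex
    have hinj := key k hk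
    have hmem : ∀ l, l ≠ k → 1 ≤ c l := by
      intro l hl
      obtain ⟨j, rfl⟩ := Fin.exists_succAbove_eq hl
      have : c (k.succAbove j) ∈ Finset.univ.image (fun j => c (k.succAbove j)) := by simp
      rw [hk] at this
      exact (Finset.mem_Icc.1 this).1
    have hinj' : ∀ a b, a ≠ k → b ≠ k → c a = c b → a = b := by
      intro a b ha hb hab
      obtain ⟨j, rfl⟩ := Fin.exists_succAbove_eq ha
      obtain ⟨j', rfl⟩ := Fin.exists_succAbove_eq hb
      rw [hinj hab]
    have hsurj : ∀ v, 1 ≤ v → v ≤ n+1 → ∃ l, l ≠ k ∧ c l = v := by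
      intro v h1 h2
      have : v ∈ Finset.univ.image (fun j => c (k.succAbove j)) := by
        rw [hk]; exact Finset.mem_Icc.2 ⟨h1, h2⟩
      obtain ⟨j, -, hj⟩ := Finset.mem_image.1 this
      exact ⟨k.succAbove j, Fin.succAbove_ne _ _, hj⟩
    by_cases h0 : c k = 0
    · have hR : Finset.univ.image c = Finset.range (n+2) := by
        ext v
        simp only [Finset.mem_image, Finset.mem_univ, true_and, Finset.mem_range]
        constructor
        · rintro ⟨l, rfl⟩; have := hc l; omega
        · intro hv
          rcases Nat.eq_zero_or_pos v with rfl | hv0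
          · exact ⟨k, h0⟩
          · obtain ⟨l, _, hl⟩ := hsurj v hv0 (by omega); exact ⟨l, hl⟩
      rw [Finset.sum_eq_single k]
      · simp [rb, dr, hR, hk]
      · intro l _ hl
        simp only [dr]
        rw [if_neg]
        intro h
        obtain ⟨j, hj⟩ := Fin.exists_succAbove_eq (Ne.symm hl)
        have : c (l.succAbove j) ∈ Finset.univ.image (fun j => c (l.succAbove j)) := by simp
        rw [h, hj, h0] at this
        simp at this
      · simp
    · obtain ⟨l, hlk, hl⟩ := hsurj (c k) (by omega) (hc k)
      have hR : Finset.univ.image c ≠ Finset.range (n+2) := by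
        intro h
        have : (0:ℕ) ∈ Finset.univ.image c := by rw [h]; simp
        obtain ⟨a, -, ha⟩ := Finset.mem_image.1 this
        by_cases hak : a = k
        · subst hak; exact h0 ha
        · have := hmem a hak; omega
      have hl' : Finset.univ.image (fun j => c (l.succAbove j)) = Finset.Icc 1 (n+1) := by
        rw [← hk]
        ext v
        simp only [Finset.mem_image, Finset.mem_univ, true_and]
        constructor
        · rintro ⟨j, rfl⟩
          by_cases hj : l.succAbove j = k
          · obtain ⟨j', hj'⟩ := Fin.exists_succAbove_eq hlk
            exact ⟨j', by rw [hj', hl, hj]⟩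
          · obtain ⟨j', hj'⟩ := Fin.exists_succAbove_eq hj
            exact ⟨j', by rw [hj']⟩
        · rintro ⟨j, rfl⟩
          by_cases hj : k.succAbove j = l
          · obtain ⟨j', hj'⟩ := Fin.exists_succAbove_eq (Ne.symm hlk)
            exact ⟨j', by rw [hj', hj, hl]⟩
          · obtain ⟨j', hj'⟩ := Fin.exists_succAbove_eq hj
            exact ⟨j', by rw [hj']⟩
      have : ∑ a : Fin (n+2), dr (fun j => c (a.succAbove j)) =
          ∑ a ∈ ({k, l} : Finset (Fin (n+2))), dr (fun j => c (a.succAbove j)) := by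
        symm
        apply Finset.sum_subset (Finset.subset_univ _)
        intro a _ ha
        simp only [Finset.mem_insert, Finset.mem_singleton, not_or] at ha
        simp only [dr]
        rw [if_neg]
        intro h
        have hi := key a h
        obtain ⟨j, hj⟩ := Fin.exists_succAbove_eq (Ne.symm ha.1)
        obtain ⟨j', hj'⟩ := Fin.exists_succAbove_eq (Ne.symm ha.2)
        have : j = j' := hi (by simp only [hj, hj', hl])
        rw [← this, hj] at hj'
        exact hlk hj'.symm
      rw [this, Finset.sum_pair (Ne.symm hlk)]
      simp only [rb, dr, hR, hk, hl', if_true, if_false]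
      decide
  · have hR : Finset.univ.image c ≠ Finset.range (n+2) := by
      intro h
      apply hex
      have h0 : (0:ℕ) ∈ Finset.univ.image c := by rw [h]; simp
      obtain ⟨k, -, hk⟩ := Finset.mem_image.1 h0
      refine ⟨k, ?_⟩
      have hinj : Function.Injective c := by
        have : (Finset.univ.image c).card = (Finset.univ : Finset (Fin (n+2))).card := by
          rw [h]; simp
        have := Finset.card_image_iff.1 this
        intro a b hab
        exact this (by simp) (by simp) hab
      ext v
      simp only [Finset.mem_image, Finset.mem_univ, true_and, Finset.mem_Icc]
      constructor
      · rintro ⟨j, rfl⟩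
        refine ⟨?_, hc _⟩
        rcases Nat.eq_zero_or_pos (c (k.succAbove j)) with h' | h'
        · exact absurd (hinj (h'.trans hk.symm)) (Fin.succAbove_ne _ _)
        · exact h'
      · rintro ⟨h1, h2⟩
        have : v ∈ Finset.univ.image c := by rw [h]; simp; omega
        obtain ⟨l, -, hl⟩ := Finset.mem_image.1 this
        have : l ≠ k := by rintro rfl; omega
        obtain ⟨j, hj⟩ := Fin.exists_succAbove_eq this
        exact ⟨j, by rw [hj, hl]⟩
    push Not at hex
    simp only [rb, dr, hR, if_false, hex, Finset.sum_const_zero]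

end KS


namespace KS


lemma middle_zero {n : ℕ} (lam : (Fin (n+1) → ℕ) → ℕ) (z : Fin (n+1) → ℕ) (i : Fin n) :
    ∑ τ : Equiv.Perm (Fin (n+1)),
      dr (fun j : Fin (n+1) => lam (vert z τ ((i.castSucc.succ : Fin (n+2)).succAbove j : Fin (n+2)))) = 0 := by
  classical
  have hne : i.castSucc ≠ i.succ := by
    intro h; have := congrArg Fin.val h; simp at this
  have hinv : ∀ (τ : Equiv.Perm (Fin (n+1))) (j : Fin (n+1)),
      vert z (Equiv.swap i.castSucc i.succ * τ) ((i.castSucc.succ : Fin (n+2)).succAbove j : Fin (n+2))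
        = vert z τ ((i.castSucc.succ : Fin (n+2)).succAbove j : Fin (n+2)) := by
    intro τ j
    have hk : (((i.castSucc.succ : Fin (n+2)).succAbove j : Fin (n+2)) : ℕ) ≠ i + 1 := by
      intro h
      exact Fin.succAbove_ne (i.castSucc.succ : Fin (n+2)) j (Fin.ext (by simpa using h))
    generalize (((i.castSucc.succ : Fin (n+2)).succAbove j : Fin (n+2)) : ℕ) = k at hk
    funext l
    simp only [vert, Equiv.Perm.mul_apply, Equiv.swap_apply_def]
    congr 1
    split_ifs with h1 h2 h3 h4 h5 <;> simp_all <;> omega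
  refine Finset.sum_involution (fun τ _ => Equiv.swap i.castSucc i.succ * τ) ?_ ?_ ?_ ?_
  · intro τ _
    simp only [hinv]
    exact CharTwo.add_self_eq_zero _
  · intro τ _ _ h
    have : Equiv.swap i.castSucc i.succ = 1 := by simpa using h
    rw [Equiv.swap_eq_one_iff] at this
    exact hne this
  · intros; simp
  · intro τ _
    simp [← mul_assoc]

lemma vert_eq_fac_zero {n : ℕ} (z : Fin (n+1) → ℕ) (τ : Equiv.Perm (Fin (n+1))) (k : ℕ) :
    vert z τ (k+1) = fac (fun i => z i + if i = τ.symm 0 then 1 else 0) τ k := by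
  funext i
  simp only [vert, fac]
  have : (i = τ.symm 0) ↔ τ i = 0 := by rw [Equiv.eq_symm_apply]
  simp only [this]
  by_cases h : τ i = 0
  · simp [h]
  · simp [h]

lemma vert_eq_fac_last {n : ℕ} (z : Fin (n+1) → ℕ) (τ : Equiv.Perm (Fin (n+1))) (k : ℕ)
    (hk : k ≤ n) :
    vert z τ k = fac z (finRotate (n+1) * τ) k := by
  funext i
  simp only [vert, fac, Equiv.Perm.mul_apply]
  have h1 := coe_finRotate (τ i)
  have h2 : finRotate (n+1) (τ i) = 0 ↔ τ i = Fin.last n := by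
    rw [← finRotate_last (n := n)]; exact (finRotate (n+1)).injective.eq_iff
  have h3 := (τ i).2
  congr 1
  by_cases h : τ i = Fin.last n
  · simp [h]; omega
  · rw [if_neg h] at h1
    simp only [h1, Ne, h2, h, not_false_eq_true, true_and, Nat.succ_le_iff]

/-- Insert a natural number coordinate. -/
def Z {n m : ℕ} (p : Fin (n+1)) (a : ℕ) (w : Fin n → Fin m) : Fin (n+1) → ℕ :=
  Fin.insertNth (α := fun _ => ℕ) p a (fun j => (w j : ℕ))

lemma sum_tel {n m : ℕ} (p : Fin (n+1)) (f : (Fin (n+1) → ℕ) → ZMod 2) :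
    ∑ z : Fin (n+1) → Fin m, (f (fun i => (z i : ℕ) + if i = p then 1 else 0) + f (fun i => z i))
      = ∑ w : Fin n → Fin m, (f (Z p m w) + f (Z p 0 w)) := by
  rw [← (Fin.insertNthEquiv (fun _ => Fin m) p).sum_comp, Fintype.sum_prod_type_right]
  refine Finset.sum_congr rfl fun w _ => ?_
  have h1 : ∀ a : Fin m, (fun i => (((Fin.insertNthEquiv (fun _ => Fin m) p) (a, w) i : Fin m) : ℕ))
      = Z p a w := by
    intro a
    funext i
    rcases Fin.eq_self_or_eq_succAbove p i with rfl | ⟨j, rfl⟩ <;> simp [Z, Fin.insertNthEquiv]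
  have h2 : ∀ a : Fin m, (fun i => (((Fin.insertNthEquiv (fun _ => Fin m) p) (a, w) i : Fin m) : ℕ)
      + if i = p then 1 else 0) = Z p (a+1) w := by
    intro a
    funext i
    rcases Fin.eq_self_or_eq_succAbove p i with rfl | ⟨j, rfl⟩ <;>
      simp [Z, Fin.insertNthEquiv]
  simp only [h1, h2]
  rw [Fin.sum_univ_eq_sum_range (fun a => f (Z p (a+1) w) + f (Z p a w)) m]
  have := Finset.sum_range_sub (fun a => f (Z p a w)) m
  simp only [CharTwo.sub_eq_add] at this
  exact this

lemma fac_le {n m : ℕ} (p : Fin (n+1)) (a : ℕ) (ha : a ≤ m) (w : Fin n → Fin m)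
    (τ : Equiv.Perm (Fin (n+1))) (hp : τ p = 0) (k : ℕ) :
    (∀ i, fac (Z p a w) τ k i ≤ m) ∧ fac (Z p a w) τ k p = a := by
  constructor
  · intro i
    rcases Fin.eq_self_or_eq_succAbove p i with rfl | ⟨j, rfl⟩
    · simp [fac, Z, hp, ha]
    · have := (w j).2
      simp only [fac, Z, Fin.insertNth_apply_succAbove]
      split_ifs <;> omega
  · simp [fac, Z, hp]

theorem sperner {m : ℕ} : ∀ (n : ℕ) (lam : (Fin n → ℕ) → ℕ)
    (_ : ∀ x, (∀ i, x i ≤ m) → lam x ≤ n)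
    (_ : ∀ x, (∀ i, x i ≤ m) → ∀ i : Fin n, x i = 0 → (i : ℕ) + 1 ≤ lam x)
    (_ : ∀ x, (∀ i, x i ≤ m) → ∀ i : Fin n, x i = m → lam x ≠ (i : ℕ) + 1),
    ∑ z : Fin n → Fin m, ∑ τ : Equiv.Perm (Fin n),
      rb (fun k : Fin (n+1) => lam (vert (fun i => (z i : ℕ)) τ k)) = 1 := by
  classical
  intro n
  induction n with
  | zero =>
    intro lam h1 _ _
    have h0 : ∀ x, lam x = 0 := fun x => Nat.le_zero.1 (h1 x (fun i => i.elim0))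
    simp [rb, h0]
  | succ n ih =>
    intro lam h1 h2 h3
    have hv : ∀ (z : Fin (n+1) → Fin m) (τ : Equiv.Perm (Fin (n+1))) (k : ℕ) (i : Fin (n+1)),
        vert (fun i => (z i : ℕ)) τ k i ≤ m := by
      intro z τ k i
      have := (z i).2
      simp only [vert]; split_ifs <;> omega
    have e1 : ∀ (z : Fin (n+1) → Fin m) (τ : Equiv.Perm (Fin (n+1))),
        rb (fun k : Fin (n+1+1) => lam (vert (fun i => (z i : ℕ)) τ k)) =
        ∑ k : Fin (n+2), dr (fun j => lam (vert (fun i => (z i : ℕ)) τ (k.succAbove j : Fin (n+2)))) := by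
      intro z τ
      exact local_count (fun k : Fin (n+2) => lam (vert (fun i => (z i : ℕ)) τ k))
        (fun k => h1 _ (hv z τ k))
    have e2 : ∀ (z : Fin (n+1) → Fin m), ∑ τ : Equiv.Perm (Fin (n+1)),
        rb (fun k : Fin (n+1+1) => lam (vert (fun i => (z i : ℕ)) τ k)) =
        ∑ τ : Equiv.Perm (Fin (n+1)),
         (dr (fun j : Fin (n+1) => lam (fac (fun i => (z i : ℕ) + if i = τ.symm 0 then 1 else 0) τ j)) +
          dr (fun j : Fin (n+1) => lam (fac (fun i => (z i : ℕ)) τ j))) := by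
      intro z
      simp only [e1]
      rw [Finset.sum_comm, Fin.sum_univ_succ, Fin.sum_univ_castSucc]
      have hmid : ∑ i : Fin n, ∑ τ : Equiv.Perm (Fin (n+1)),
          dr (fun j : Fin (n+1) => lam (vert (fun i => (z i : ℕ)) τ
            ((i.castSucc.succ : Fin (n+2)).succAbove j : Fin (n+2)))) = 0 :=
        Finset.sum_eq_zero fun i _ => middle_zero lam _ i
      rw [hmid, zero_add, Finset.sum_add_distrib]
      congr 1
      · refine Finset.sum_congr rfl fun τ _ => ?_
        congr 1
        funext j
        rw [← vert_eq_fac_zero]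
        simp
      · rw [← Equiv.sum_comp (Equiv.mulLeft (finRotate (n+1))) (fun τ : Equiv.Perm (Fin (n+1)) => dr (fun j : Fin (n+1) => lam (fac (fun i => (z i : ℕ)) τ j)))]
        refine Finset.sum_congr rfl fun τ _ => ?_
        congr 1
        funext j
        have := vert_eq_fac_last (fun i => (z i : ℕ)) τ j (Nat.lt_succ_iff.1 j.2)
        simp only [Equiv.coe_mulLeft, Fin.succ_last, Fin.succAbove_last, Fin.val_castSucc]
        rw [this]
    simp only [e2]
    rw [Finset.sum_comm]
    have e3 : ∀ τ : Equiv.Perm (Fin (n+1)),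
        ∑ z : Fin (n+1) → Fin m,
         (dr (fun j : Fin (n+1) => lam (fac (fun i => (z i : ℕ) + if i = τ.symm 0 then 1 else 0) τ j)) +
          dr (fun j : Fin (n+1) => lam (fac (fun i => (z i : ℕ)) τ j))) =
        ∑ w : Fin n → Fin m, dr (fun j : Fin (n+1) => lam (fac (Z (τ.symm 0) 0 w) τ j)) := by
      intro τ
      have hp : τ (τ.symm 0) = 0 := by simp
      rw [sum_tel (τ.symm 0) (fun z => dr (fun j : Fin (n+1) => lam (fac z τ j)))]
      refine Finset.sum_congr rfl fun w _ => ?_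
      have : dr (fun j : Fin (n+1) => lam (fac (Z (τ.symm 0) m w) τ j)) = 0 := by
        simp only [dr]
        rw [if_neg]
        intro h
        have hmem : ((τ.symm 0 : Fin (n+1)) : ℕ) + 1 ∈ Finset.Icc 1 (n+1) := by
          have := (τ.symm 0).2
          simp only [Finset.mem_Icc]; omega
        rw [← h] at hmem
        obtain ⟨j, -, hj⟩ := Finset.mem_image.1 hmem
        have hf := fac_le (τ.symm 0) m le_rfl w τ hp j
        exact h3 _ hf.1 _ hf.2 hj
      rw [this, zero_add]
    simp only [e3]
    rw [← (Equiv.Perm.decomposeFin (n := n)).symm.sum_comp, Fintype.sum_prod_type,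
      Finset.sum_eq_single 0]
    · rw [← ih (fun w => lam (Fin.cons (α := fun _ => ℕ) 0 w) - 1) ?_ ?_ ?_, Finset.sum_comm]
      · refine Finset.sum_congr rfl fun w _ => Finset.sum_congr rfl fun e _ => ?_
        set τ := (Equiv.Perm.decomposeFin (n := n)).symm (0, e) with hτ
        have ht0 : τ 0 = 0 := by simp [hτ]
        have hts : τ.symm 0 = 0 := by rw [Equiv.symm_apply_eq, ht0]
        have htsucc : ∀ x : Fin n, τ x.succ = (e x).succ := by intro x; simp [hτ]
        rw [hts]
        have hfac : ∀ j : ℕ, fac (Z 0 0 w) τ j =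
            Fin.cons (α := fun _ => ℕ) 0 (vert (fun i => (w i : ℕ)) e j) := by
          intro j
          funext i
          refine Fin.cases ?_ (fun i => ?_) i
          · simp [fac, Z, ht0]
          · simp only [fac, Z, htsucc, Fin.cons_succ, vert]
            rw [Fin.insertNth_zero]
            simp [Fin.succ_ne_zero]
        simp only [hfac]
        have hge : ∀ j : ℕ, 1 ≤ lam (Fin.cons (α := fun _ => ℕ) 0 (vert (fun i => (w i : ℕ)) e j)) := by
          intro j
          rw [← hfac j]
          have hf := fac_le 0 0 (Nat.zero_le m) w τ ht0 j
          have := h2 _ hf.1 _ hf.2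
          simpa using this
        simp only [dr, rb]
        congr 1
        apply propext
        set L : Fin (n+1) → ℕ := fun j =>
          lam (Fin.cons (α := fun _ => ℕ) 0 (vert (fun i => (w i : ℕ)) e j)) with hL
        have hLge : ∀ j, 1 ≤ L j := fun j => hge j
        constructor
        · intro h
          ext v
          have := Finset.ext_iff.1 h (v+1)
          simp only [Finset.mem_image, Finset.mem_univ, true_and, Finset.mem_Icc] at this
          simp only [Finset.mem_image, Finset.mem_univ, true_and, Finset.mem_range]
          constructor
          · rintro ⟨j, hj⟩
            have h4 := hLge j
            have := this.1 ⟨j, by simp only [hL] at h4 ⊢; omega⟩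
            omega
          · intro hv
            obtain ⟨j, hj⟩ := this.2 (by omega)
            exact ⟨j, by simp only [hL] at hj; omega⟩
        · intro h
          ext v
          have := Finset.ext_iff.1 h (v-1)
          simp only [Finset.mem_image, Finset.mem_univ, true_and, Finset.mem_range] at this
          simp only [Finset.mem_image, Finset.mem_univ, true_and, Finset.mem_Icc]
          constructor
          · rintro ⟨j, hj⟩
            have h4 := hLge j
            have := this.1 ⟨j, by simp only [hL] at hj; omega⟩
            omega
          · intro hv
            obtain ⟨j, hj⟩ := this.2 (by omega)
            have h4 := hLge j
            exact ⟨j, by simp only [hL] at h4 ⊢; omega⟩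
      · intro x hx
        have := h1 (Fin.cons (α := fun _ => ℕ) 0 x) (fun i => by
          refine Fin.cases ?_ (fun i => ?_) i
          · simp
          · simpa using hx i)
        omega
      · intro x hx i hi
        have := h2 (Fin.cons (α := fun _ => ℕ) 0 x) (fun i => by
          refine Fin.cases ?_ (fun i => ?_) i
          · simp
          · simpa using hx i) i.succ (by simpa using hi)
        simp at this
        omega
      · intro x hx i hi
        have := h3 (Fin.cons (α := fun _ => ℕ) 0 x) (fun i => by
          refine Fin.cases ?_ (fun i => ?_) i
          · simp
          · simpa using hx i) i.succ (by simpa using hi)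
        simp at this
        omega
    · intro p _ hp
      refine Finset.sum_eq_zero fun e _ => Finset.sum_eq_zero fun w _ => ?_
      set τ := (Equiv.Perm.decomposeFin (n := n)).symm (p, e) with hτ
      have ht0 : τ 0 = p := by simp [hτ]
      simp only [dr]
      rw [if_neg]
      intro h
      have hmem : 1 ∈ Finset.Icc 1 (n+1) := by simp
      rw [← h] at hmem
      obtain ⟨j, -, hj⟩ := Finset.mem_image.1 hmem
      have hf := fac_le (τ.symm 0) 0 (Nat.zero_le m) w τ (by simp) j
      have := h2 _ hf.1 _ hf.2
      rw [hj] at this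
      have h0 : τ.symm 0 = 0 := Fin.ext (by simpa using this)
      rw [Equiv.symm_apply_eq, ht0] at h0
      exact hp h0.symm
    · simp

end KS


/-! ## Lebesgue's covering theorem -/

theorem cube_dim_le {n k : ℕ} {Y : Type*} [TopologicalSpace Y] [T2Space Y]
    (e : ↥(Icc (0 : Fin n → ℝ) 1) → Y) (hec : Continuous e) (hei : Function.Injective e)
    (hY : DimLE Y k) : n ≤ k := by
  classical
  by_contra hlt
  push Not at hlt
  have hemb : Topology.IsClosedEmbedding e := hec.isClosedEmbedding hei
  -- the cover
  have hO : ∀ x : ↥(Icc (0 : Fin n → ℝ) 1), ∃ O : Set Y, IsOpen O ∧ e ⁻¹' O = Metric.ball x (1/3) := by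
    intro x
    obtain ⟨O, hO, h⟩ := hemb.isInducing.isOpen_iff.1 (Metric.isOpen_ball (x := x) (ε := 1/3))
    exact ⟨O, hO, h⟩
  choose O hOo hOb using hO
  let U : Option ↥(Icc (0 : Fin n → ℝ) 1) → Set Y := fun o => o.elim (Set.range e)ᶜ O
  obtain ⟨κ, V, hVo, hVc, hVU, hVm⟩ := hY _ U (by
      rintro (_ | x)
      · exact hemb.isClosed_range.isOpen_compl
      · exact hOo x) (by
      rw [Set.eq_univ_iff_forall]
      intro y
      by_cases hy : y ∈ Set.range e
      · obtain ⟨x, rfl⟩ := hy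
        refine Set.mem_iUnion.2 ⟨some x, ?_⟩
        have : x ∈ e ⁻¹' O x := by rw [hOb]; simp
        exact this
      · exact Set.mem_iUnion.2 ⟨none, hy⟩)
  let W : κ → Set ↥(Icc (0 : Fin n → ℝ) 1) := fun j => e ⁻¹' V j
  have hWsmall : ∀ j, ∀ x ∈ W j, ∀ y ∈ W j, dist x y < 1 := by
    intro j x hx y hy
    obtain ⟨o, ho⟩ := hVU j
    rcases o with _ | c
    · exact absurd (Set.mem_range_self x) (ho hx)
    · have h1 : x ∈ e ⁻¹' O c := ho hx
      have h2 : y ∈ e ⁻¹' O c := ho hy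
      rw [hOb, Metric.mem_ball] at h1 h2
      have := dist_triangle_right x y c
      linarith
  obtain ⟨δ, hδ, hleb⟩ := lebesgue_number_lemma_of_metric (s := (Set.univ : Set ↥(Icc (0 : Fin n → ℝ) 1)))
    (c := W) isCompact_univ (fun j => (hVo j).preimage hec) (by
      intro x _
      have : e x ∈ ⋃ j, V j := by rw [hVc]; trivial
      obtain ⟨j, hj⟩ := Set.mem_iUnion.1 this
      exact Set.mem_iUnion.2 ⟨j, hj⟩)
  obtain ⟨m', hm'⟩ := exists_nat_gt (1/δ)
  let m := m' + 1
  have hmpos : (0:ℝ) < m := by positivity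
  have hmδ : 1 / (m:ℝ) < δ := by
    rw [div_lt_iff₀ hmpos]
    rw [div_lt_iff₀ hδ] at hm'
    have : (m:ℝ) = m' + 1 := by simp [m]
    nlinarith
  -- grid points
  let pt : (Fin n → ℕ) → ↥(Icc (0 : Fin n → ℝ) 1) := fun x =>
    ⟨fun i => min ((x i : ℝ) / m) 1, by
      constructor
      · intro i; simp only [Pi.zero_apply]; positivity
      · intro i; exact min_le_right _ _⟩
  have hlab : ∀ x : ↥(Icc (0 : Fin n → ℝ) 1), ∃ j, Metric.ball x δ ⊆ W j := fun x => hleb x trivial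
  choose J hJ using hlab
  let col : κ → ℕ := fun j =>
    (Finset.univ.filter (fun i : Fin n => ∃ y ∈ W j, y.1 i = 0)).sup (fun i => (i:ℕ) + 1)
  have hcol_le : ∀ j, col j ≤ n := by
    intro j
    refine Finset.sup_le fun i _ => ?_
    have := i.2; omega
  have hself : ∀ x, x ∈ W (J x) := fun x => hJ x (Metric.mem_ball_self hδ)
  have hsp := KS.sperner (m := m) n (fun x => col (J (pt x))) (fun x _ => hcol_le _)
    (by
      intro x _ i hi
      have : i ∈ Finset.univ.filter (fun i : Fin n => ∃ y ∈ W (J (pt x)), y.1 i = 0) := by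
        simp only [Finset.mem_filter, Finset.mem_univ, true_and]
        exact ⟨pt x, hself _, by simp [pt, hi]⟩
      exact Finset.le_sup (f := fun i : Fin n => (i:ℕ) + 1) this)
    (by
      intro x _ i hi hc
      have hne : (Finset.univ.filter (fun i : Fin n => ∃ y ∈ W (J (pt x)), y.1 i = 0)).Nonempty := by
        by_contra hcon
        rw [Finset.not_nonempty_iff_eq_empty] at hcon
        simp only [col, hcon, Finset.sup_empty] at hc
        simp at hc
      obtain ⟨i', hi', hs⟩ := Finset.exists_mem_eq_sup _ hne (fun i : Fin n => (i:ℕ) + 1)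
      have hii : i' = i := by
        apply Fin.ext
        have : col (J (pt x)) = (i':ℕ) + 1 := hs
        omega
      subst hii
      simp only [Finset.mem_filter, Finset.mem_univ, true_and] at hi'
      obtain ⟨y, hy, hy0⟩ := hi'
      have hd := hWsmall _ _ (hself (pt x)) _ hy
      have h1 : dist ((pt x).1 i') (y.1 i') ≤ dist (pt x) y := dist_le_pi_dist (pt x).1 y.1 i'
      have h2 : (pt x).1 i' = 1 := by
        simp only [pt, hi]
        rw [div_self hmpos.ne', min_self]
      rw [h2, hy0] at h1
      simp at h1
      linarith)
  have hex : ∃ (z : Fin n → Fin m) (τ : Equiv.Perm (Fin n)),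
      KS.rb (fun k : Fin (n+1) => col (J (pt (KS.vert (fun i => (z i : ℕ)) τ k)))) ≠ 0 := by
    by_contra hcon
    push Not at hcon
    simp only [hcon, Finset.sum_const_zero] at hsp
    exact zero_ne_one hsp
  obtain ⟨z, τ, hrb⟩ := hex
  set v : Fin (n+1) → ↥(Icc (0 : Fin n → ℝ) 1) := fun k => pt (KS.vert (fun i => (z i : ℕ)) τ k) with hv
  have himg : Finset.univ.image (fun k => col (J (v k))) = Finset.range (n+1) := by
    by_contra h
    exact hrb (by simp only [KS.rb]; rw [if_neg h])
  have hinj : Function.Injective (fun k => J (v k)) := by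
    have : (Finset.univ.image (fun k => col (J (v k)))).card = (Finset.univ : Finset (Fin (n+1))).card := by
      rw [himg]; simp
    have := Finset.card_image_iff.1 this
    intro a b hab
    exact this (by simp) (by simp) (by simp only at hab ⊢; rw [hab])
  have hmem : ∀ k, v 0 ∈ W (J (v k)) := by
    intro k
    apply hJ
    rw [Metric.mem_ball]
    refine lt_of_le_of_lt ?_ hmδ
    change dist (v 0).1 (v k).1 ≤ _
    rw [dist_pi_le_iff (by positivity)]
    intro i
    simp only [hv, pt, KS.vert]
    rw [Real.dist_eq]
    refine (abs_min_sub_min_le_max _ _ _ _).trans ?_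
    rw [sub_self, abs_zero]
    refine max_le ?_ (by positivity)
    rw [← sub_div, abs_div, abs_of_pos hmpos]
    gcongr
    simp only [Fin.val_zero, Nat.not_lt_zero, if_false]
    split_ifs <;> simp
  obtain ⟨hfin, hcard⟩ := hVm (e (v 0))
  have hsub : Set.range (fun k => J (v k)) ⊆ {j | e (v 0) ∈ V j} := by
    rintro _ ⟨k, rfl⟩; exact hmem k
  have h1 := Set.ncard_le_ncard hsub hfin
  rw [Set.ncard_range_of_injective hinj] at h1
  simp at h1
  omega


namespace CatGeo

variable {X : Type*} [MetricSpace X]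

theorem eval_continuous (x : X) : Continuous (fun g : X ≃ᵢ X => g x) :=
  (continuous_apply x).comp continuous_induced_dom

instance isomT2 : T2Space (X ≃ᵢ X) := by
  refine T2Space.of_injective_continuous (f := fun g : X ≃ᵢ X => ⇑g) ?_ continuous_induced_dom
  intro g h e
  exact IsometryEquiv.ext fun x => congrFun e x

theorem isom_mul_continuous : Continuous (fun q : (X ≃ᵢ X) × (X ≃ᵢ X) => q.1 * q.2) := by
  refine continuous_induced_rng.2 (continuous_pi fun x => ?_)
  rw [continuous_iff_continuousAt]
  rintro ⟨g, h⟩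
  show Filter.Tendsto (fun q : (X ≃ᵢ X) × (X ≃ᵢ X) => q.1 (q.2 x)) (nhds (g, h)) (nhds (g (h x)))
  rw [tendsto_iff_dist_tendsto_zero]
  have h1 : Filter.Tendsto (fun q : (X ≃ᵢ X) × (X ≃ᵢ X) => dist (q.2 x) (h x) +
      dist (q.1 (h x)) (g (h x))) (nhds (g, h)) (nhds (dist (h x) (h x) + dist (g (h x)) (g (h x)))) := by
    have c : Continuous (fun q : (X ≃ᵢ X) × (X ≃ᵢ X) => dist (q.2 x) (h x) +
      dist (q.1 (h x)) (g (h x))) := by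
      have e1 := (eval_continuous x).comp (continuous_snd (X := X ≃ᵢ X) (Y := X ≃ᵢ X))
      have e2 := (eval_continuous (h x)).comp (continuous_fst (X := X ≃ᵢ X) (Y := X ≃ᵢ X))
      exact (e1.dist continuous_const).add (e2.dist continuous_const)
    exact c.tendsto (g, h)
  rw [dist_self, dist_self, add_zero] at h1
  refine squeeze_zero (fun _ => dist_nonneg) (fun q => ?_) h1
  have := dist_triangle (q.1 (q.2 x)) (q.1 (h x)) (g (h x))
  rwa [q.1.dist_eq] at this

theorem isom_nhds_one {O : Set (X ≃ᵢ X)} (hO : IsOpen O) (h1 : (1 : X ≃ᵢ X) ∈ O) :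
    ∃ F : Finset X, ∃ δ > 0, ∀ g : X ≃ᵢ X, (∀ f ∈ F, dist (g f) f < δ) → g ∈ O := by
  obtain ⟨O', hO', rfl⟩ := isOpen_induced_iff.1 hO
  rw [isOpen_pi_iff] at hO'
  obtain ⟨I, u, hu, hsub⟩ := hO' _ h1
  have : ∀ a : X, ∃ δ > 0, a ∈ I → Metric.ball a δ ⊆ u a := by
    intro a
    by_cases ha : a ∈ I
    · obtain ⟨δ, hδ, hb⟩ := Metric.isOpen_iff.1 (hu a ha).1 a (by simpa using (hu a ha).2)
      exact ⟨δ, hδ, fun _ => hb⟩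
    · exact ⟨1, one_pos, fun h => absurd h ha⟩
  choose d hd0 hd using this
  have hfin : ∃ δ > 0, ∀ a ∈ I, δ ≤ d a := by
    clear hsub hu hd
    induction I using Finset.cons_induction with
    | empty => exact ⟨1, one_pos, by simp⟩
    | cons a s ha ih =>
      obtain ⟨δ, h0, h⟩ := ih
      refine ⟨min δ (d a), lt_min h0 (hd0 a), ?_⟩
      intro b hb
      rcases Finset.mem_cons.1 hb with rfl | hb
      · exact min_le_right _ _
      · exact (min_le_left _ _).trans (h b hb)
  obtain ⟨δ, h0, hδ⟩ := hfin
  refine ⟨I, δ, h0, fun g hg => hsub ?_⟩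
  intro a ha
  exact hd a ha (Metric.mem_ball.2 ((hg a ha).trans_le (hδ a ha)))

theorem isom_compact [ProperSpace X] (G : Subgroup (X ≃ᵢ X))
    (hclosed : IsClosed (G : Set (X ≃ᵢ X))) (x0 : X) (R : ℝ) :
    IsCompact {g : X ≃ᵢ X | g ∈ G ∧ dist (g x0) x0 ≤ R} := by
  rw [isCompact_iff_ultrafilter_le_nhds]
  intro U hU
  have hU' : {g : X ≃ᵢ X | g ∈ G ∧ dist (g x0) x0 ≤ R} ∈ U := Filter.le_principal_iff.1 hU
  have lim : ∀ φ : (X ≃ᵢ X) → X, (∃ z, ∃ r, ∀ g : X ≃ᵢ X, dist (g x0) x0 ≤ R → dist (φ g) z ≤ r) →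
      ∃ y, Filter.Tendsto φ U (nhds y) := by
    rintro φ ⟨z, r, h⟩
    have hm : ((U.map φ : Ultrafilter X) : Filter X) ≤ Filter.principal (Metric.closedBall z r) := by
      rw [Filter.le_principal_iff]
      show φ ⁻¹' _ ∈ U
      filter_upwards [hU'] with g hg
      exact h g hg.2
    obtain ⟨y, _, hy⟩ := (isCompact_closedBall z r).ultrafilter_le_nhds _ hm
    exact ⟨y, hy⟩
  have hf : ∀ x, ∃ y, Filter.Tendsto (fun g : X ≃ᵢ X => g x) U (nhds y) := fun x =>
    lim _ ⟨x0, dist x x0 + R, fun g hg => by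
      have := dist_triangle (g x) (g x0) x0
      rw [g.dist_eq] at this; linarith⟩
  have hf' : ∀ x, ∃ y, Filter.Tendsto (fun g : X ≃ᵢ X => g.symm x) U (nhds y) := fun x =>
    lim _ ⟨x0, dist x x0 + R, fun g hg => by
      have h1 := g.dist_eq (g.symm x) x0
      rw [g.apply_symm_apply] at h1
      have := dist_triangle_right x (g x0) x0
      linarith⟩
  choose f hf using hf
  choose f' hf' using hf'
  have uniq : ∀ (φ : (X ≃ᵢ X) → ℝ) (a b : ℝ), Filter.Tendsto φ U (nhds a) →
    Filter.Tendsto φ U (nhds b) → a = b := fun φ a b h1 h2 => tendsto_nhds_unique h1 h2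
  have hiso : ∀ x y, dist (f x) (f y) = dist x y := by
    intro x y
    refine uniq (fun g => dist (g x) (g y)) _ _ ((hf x).dist (hf y)) ?_
    simp only [IsometryEquiv.dist_eq]
    exact tendsto_const_nhds
  have h1 : ∀ x, f (f' x) = x := by
    intro x
    refine dist_eq_zero.1 (uniq (fun g => dist (g (f' x)) x) _ _ ((hf _).dist tendsto_const_nhds) ?_)
    have : (fun g : X ≃ᵢ X => dist (g (f' x)) x) = fun g => dist (f' x) (g.symm x) := by
      funext g
      rw [← g.dist_eq (f' x) (g.symm x), g.apply_symm_apply]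
    rw [this, ← dist_self (f' x)]
    exact tendsto_const_nhds.dist (hf' x)
  have h2 : ∀ x, f' (f x) = x := by
    intro x
    have hinj : Function.Injective f := fun a b e => by
      rw [← dist_eq_zero, ← hiso, e, dist_self]
    exact hinj (h1 (f x))
  let g0 : X ≃ᵢ X := ⟨⟨f, f', h2, h1⟩, Isometry.of_dist_eq hiso⟩
  have hle : (U : Filter (X ≃ᵢ X)) ≤ nhds g0 := by
    rw [nhds_induced, ← Filter.map_le_iff_le_comap]
    exact tendsto_pi_nhds.2 hf
  refine ⟨g0, ⟨?_, ?_⟩, hle⟩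
  · refine hclosed.mem_of_tendsto (f := id) (b := (U : Filter (X ≃ᵢ X))) hle ?_
    filter_upwards [hU'] with g hg using hg.1
  · refine le_of_tendsto (f := fun g : X ≃ᵢ X => dist (g x0) x0)
      ((hf x0).dist tendsto_const_nhds) ?_
    filter_upwards [hU'] with g hg using hg.2

end CatGeo


namespace CatGeo

variable {X : Type*} [MetricSpace X]

/-- elements of `G` close to the identity fix `A` pointwise -/
def NearFix (G : Subgroup (X ≃ᵢ X)) (A : Set X) : Prop :=
  ∃ F : Finset X, ∃ δ > 0, ∀ g ∈ G, (∀ f ∈ F, dist (g f) f < δ) → ∀ y ∈ A, g y = y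

theorem NearFix.union {G : Subgroup (X ≃ᵢ X)} {A B : Set X} (hA : NearFix G A)
    (hB : NearFix G B) : NearFix G (A ∪ B) := by
  classical
  obtain ⟨F, δ, hδ, h⟩ := hA
  obtain ⟨F', δ', hδ', h'⟩ := hB
  refine ⟨F ∪ F', min δ δ', lt_min hδ hδ', fun g hg hf y hy => ?_⟩
  rcases hy with hy | hy
  · exact h g hg (fun f hfF => (hf f (Finset.mem_union_left _ hfF)).trans_le (min_le_left _ _)) y hy
  · exact h' g hg (fun f hfF => (hf f (Finset.mem_union_right _ hfF)).trans_le (min_le_right _ _)) y hy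

theorem NearFix.finite {G : Subgroup (X ≃ᵢ X)} {A : Set X} (hA : A.Finite)
    (h : ∀ a ∈ A, NearFix G {a}) : NearFix G A := by
  induction A, hA using Set.Finite.induction_on with
  | empty => exact ⟨∅, 1, one_pos, by simp⟩
  | insert _ _ ih =>
    rw [← singleton_union]
    exact (h _ (mem_insert _ _)).union (ih fun a ha => h a (mem_insert_of_mem _ ha))

theorem NearFix.conj {G : Subgroup (X ≃ᵢ X)} {y : X} (h : NearFix G {y}) {g0 : X ≃ᵢ X}
    (hg0 : g0 ∈ G) : NearFix G {g0 y} := by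
  classical
  obtain ⟨F, δ, hδ, h⟩ := h
  refine ⟨F.image g0, δ, hδ, fun g hg hf z hz => ?_⟩
  rw [mem_singleton_iff] at hz
  subst hz
  have := h (g0⁻¹ * g * g0) (G.mul_mem (G.mul_mem (G.inv_mem hg0) hg) hg0) (fun f hfF => by
    have := hf (g0 f) (Finset.mem_image_of_mem _ hfF)
    rw [IsometryEquiv.mul_apply, IsometryEquiv.mul_apply, ← g0.dist_eq,
      IsometryEquiv.apply_inv_self]
    exact this) y rfl
  rw [IsometryEquiv.mul_apply, IsometryEquiv.mul_apply] at this
  have := congrArg g0 this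
  rwa [IsometryEquiv.apply_inv_self] at this

/-- van Dantzig: there is an open subgroup with bounded orbit -/
theorem exists_bounded_open_subgroup [ProperSpace X] (G : Subgroup (X ≃ᵢ X))
    (hclosed : IsClosed (G : Set (X ≃ᵢ X))) (htd : TotallyDisconnectedSpace ↥G) (x0 : X) :
    ∃ H : Subgroup (X ≃ᵢ X), (∀ h ∈ H, dist (h x0) x0 ≤ 1) ∧
      ∃ F : Finset X, ∃ δ > 0, ∀ g ∈ G, (∀ f ∈ F, dist (g f) f < δ) → g ∈ H := by
  have hKc := isom_compact G hclosed x0 1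
  set K : Set ↥G := {g | dist (g.1 x0) x0 ≤ 1} with hK
  have hK' : IsCompact K := by
    rw [Subtype.isCompact_iff]
    convert hKc using 1
    ext g
    constructor
    · rintro ⟨g, hg, rfl⟩; exact ⟨g.2, hg⟩
    · rintro ⟨h1, h2⟩; exact ⟨⟨g, h1⟩, h2, rfl⟩
  haveI : CompactSpace ↥K := isCompact_iff_compactSpace.1 hK'
  have hev : Continuous (fun g : X ≃ᵢ X => dist (g x0) x0) :=
    (eval_continuous x0).dist continuous_const
  have hopen : IsOpen {g : X ≃ᵢ X | dist (g x0) x0 < 1} := isOpen_lt hev continuous_const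
  let e1 : ↥K := ⟨1, by simp [hK]⟩
  have hopen' : IsOpen {g : ↥K | dist (g.1.1 x0) x0 < 1} :=
    hopen.preimage (continuous_subtype_val.comp continuous_subtype_val)
  obtain ⟨C', hC', h1C, hCsub⟩ := compact_exists_isClopen_in_isOpen hopen' (x := e1)
    (by simp [e1])
  obtain ⟨O1, hO1, hO1'⟩ : ∃ O1 : Set (X ≃ᵢ X), IsOpen O1 ∧ ∀ g : ↥K, g ∈ C' ↔ g.1.1 ∈ O1 := by
    obtain ⟨O2, hO2, rfl⟩ := isOpen_induced_iff.1 hC'.isOpen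
    obtain ⟨O3, hO3, rfl⟩ := isOpen_induced_iff.1 hO2
    exact ⟨O3, hO3, fun g => Iff.rfl⟩
  set O := O1 ∩ {g : X ≃ᵢ X | dist (g x0) x0 < 1} with hO
  have hOo : IsOpen O := hO1.inter hopen
  set C : Set (X ≃ᵢ X) := (fun g : ↥K => g.1.1) '' C' with hC
  have hCc : IsCompact C := hC'.isClosed.isCompact.image
    (continuous_subtype_val.comp continuous_subtype_val)
  have hCO : ∀ g, g ∈ C ↔ g ∈ G ∧ g ∈ O := by
    intro g
    constructor
    · rintro ⟨g, hg, rfl⟩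
      exact ⟨g.1.2, (hO1' g).1 hg, hCsub hg⟩
    · rintro ⟨hg, h1, h2⟩
      exact ⟨⟨⟨g, hg⟩, show dist (g x0) x0 ≤ 1 from le_of_lt h2⟩, (hO1' _).2 h1, rfl⟩
  have h1C' : (1 : X ≃ᵢ X) ∈ C := ⟨e1, h1C, rfl⟩
  obtain ⟨u, v, _, hv, hu', hv', huv⟩ := generalized_tube_lemma hCc (isCompact_singleton (x := (1 : X ≃ᵢ X)))
    (hOo.preimage isom_mul_continuous) (by
      rintro ⟨a, b⟩ ⟨ha, hb⟩
      rw [mem_singleton_iff] at hb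
      simp only at ha hb
      subst hb
      show a * 1 ∈ O
      rw [mul_one]
      exact ((hCO a).1 ha).2)
  obtain ⟨F, δ, hδ, hF⟩ := isom_nhds_one hv (hv' rfl)
  let H : Subgroup (X ≃ᵢ X) :=
    { carrier := {g | ∀ c, c ∈ C ↔ c * g ∈ C}
      mul_mem' := by
        intro a b ha hb c
        rw [← mul_assoc, ← hb, ← ha]
      one_mem' := by intro c; rw [mul_one]
      inv_mem' := by
        intro a ha c
        rw [ha (c * a⁻¹), inv_mul_cancel_right] }
  have hmul : ∀ g ∈ G, g ∈ v → ∀ c ∈ C, c * g ∈ C := by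
    intro g hg hgv c hc
    have hm : (c, g) ∈ (fun q : (X ≃ᵢ X) × (X ≃ᵢ X) => q.1 * q.2) ⁻¹' O := huv ⟨hu' hc, hgv⟩
    exact (hCO _).2 ⟨G.mul_mem ((hCO c).1 hc).1 hg, hm⟩
  refine ⟨H, ?_, F, δ, hδ, ?_⟩
  · intro h hh
    have := (hh 1).1 h1C'
    rw [one_mul] at this
    exact le_of_lt ((hCO h).1 this).2.2
  · intro g hg hf
    have hg1 : g ∈ v := hF g hf
    have hg2 : g⁻¹ ∈ v := hF g⁻¹ fun f hfF => by
      rw [← g.dist_eq, IsometryEquiv.apply_inv_self, dist_comm]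
      exact hf f hfF
    intro c
    refine ⟨hmul g hg hg1 c, fun h => ?_⟩
    have := hmul g⁻¹ (G.inv_mem hg) hg2 _ h
    rwa [mul_inv_cancel_right] at this

/-- a group with a bounded orbit has a fixed point -/
theorem exists_fixed [ProperSpace X] (hcat : IsCAT0 X) (H : Subgroup (X ≃ᵢ X)) (x0 : X)
    (hb : ∀ h ∈ H, dist (h x0) x0 ≤ 1) : ∃ y, ∀ h ∈ H, h y = y := by
  set S : Set (X × ℝ) := {q | ∀ h ∈ H, dist q.1 (h x0) ≤ q.2} ∩ {q | q.2 ≤ 1} with hS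
  have hSc : IsClosed S := by
    refine IsClosed.inter ?_ (isClosed_le continuous_snd continuous_const)
    have : {q : X × ℝ | ∀ h ∈ H, dist q.1 (h x0) ≤ q.2} =
        ⋂ h ∈ H, {q : X × ℝ | dist q.1 (h x0) ≤ q.2} := by ext q; simp
    rw [this]
    exact isClosed_biInter fun h _ => isClosed_le (by fun_prop) (by fun_prop)
  have hSK : IsCompact S := by
    refine ((isCompact_closedBall x0 1).prod (isCompact_Icc (a := (0:ℝ)) (b := 1))).of_isClosed_subset
      hSc ?_
    rintro ⟨y, r⟩ ⟨h1, h2⟩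
    have h3 := h1 1 H.one_mem
    simp only [IsometryEquiv.coe_one, id_eq] at h3
    exact ⟨h3.trans h2, dist_nonneg.trans h3, h2⟩
  obtain ⟨⟨y, r⟩, hyr, hmin⟩ := hSK.exists_isMinOn (f := fun q => q.2)
    ⟨(x0, 1), fun h hh => by simpa [dist_comm] using hb h hh, show (1:ℝ) ≤ 1 from le_rfl⟩ continuous_snd.continuousOn
  have hmin' : ∀ q ∈ S, r ≤ q.2 := hmin
  have hy1 : ∀ h ∈ H, dist y (h x0) ≤ r := hyr.1
  have hr1 : r ≤ 1 := hyr.2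
  have hr0 : 0 ≤ r := dist_nonneg.trans (hy1 1 H.one_mem)
  refine ⟨y, fun h hh => ?_⟩
  by_contra hne
  have hd : 0 < dist y (h y) := dist_pos.2 (Ne.symm hne)
  obtain ⟨m, m1, m2⟩ := hcat.1 y (h y)
  have hm : ∀ b ∈ H, dist m (b x0) ≤ Real.sqrt (r ^ 2 - dist y (h y) ^ 2 / 4) := by
    intro b hb
    apply Real.le_sqrt_of_sq_le
    have c := hcat.2 (b x0) y (h y) m m1 m2
    have a1 := hy1 b hb
    have a2 : dist (b x0) (h y) ≤ r := by
      have := hy1 (h⁻¹ * b) (H.mul_mem (H.inv_mem hh) hb)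
      rw [IsometryEquiv.mul_apply, ← h.dist_eq, IsometryEquiv.apply_inv_self] at this
      rwa [dist_comm]
    rw [dist_comm y] at a1
    rw [dist_comm m]
    have b1 := pow_le_pow_left₀ dist_nonneg a1 2
    have b2 := pow_le_pow_left₀ dist_nonneg a2 2
    linarith
  have hlt : Real.sqrt (r ^ 2 - dist y (h y) ^ 2 / 4) < r := by
    have hrp : 0 < r := by
      rcases hr0.eq_or_lt with e | e
      · exfalso
        have a1 := hy1 1 H.one_mem
        have a2 := hy1 (h⁻¹) (H.inv_mem hh)
        rw [← h.dist_eq, IsometryEquiv.apply_inv_self] at a2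
        simp only [IsometryEquiv.coe_one, id_eq] at a1
        have := dist_triangle_right y (h y) x0
        linarith
      · exact e
    rw [Real.sqrt_lt' hrp]
    have : 0 < dist y (h y) ^ 2 := by positivity
    linarith
  have := hmin' (m, _) ⟨hm, (hlt.le.trans hr1 : _ ≤ (1:ℝ))⟩
  exact absurd hlt (not_lt.2 this)

end CatGeo


namespace CatGeo

variable {X : Type*} [MetricSpace X]

theorem exists_nearFix_point [ProperSpace X] [Nonempty X] (hcat : IsCAT0 X) (G : Subgroup (X ≃ᵢ X))
    (hclosed : IsClosed (G : Set (X ≃ᵢ X))) (htd : TotallyDisconnectedSpace ↥G) :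
    ∃ y : X, NearFix G {y} := by
  obtain ⟨x0⟩ := ‹Nonempty X›
  obtain ⟨H, hb, F, δ, hδ, hF⟩ := exists_bounded_open_subgroup G hclosed htd x0
  obtain ⟨y, hy⟩ := exists_fixed hcat H x0 hb
  refine ⟨y, F, δ, hδ, fun g hg hf z hz => ?_⟩
  rw [mem_singleton_iff] at hz
  rw [hz]
  exact hy g (hF g hg hf)

theorem nearFix_ball [ProperSpace X] [Nonempty X] (hcat : IsCAT0 X) (hgc : GeodesicallyComplete X)
    (G : Subgroup (X ≃ᵢ X))
    (hclosed : IsClosed (G : Set (X ≃ᵢ X))) (htd : TotallyDisconnectedSpace ↥G)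
    {D : ℝ} (hcoc : ∀ x y : X, ∃ g ∈ G, dist y (g x) ≤ D) (x : X) :
    NearFix G (Metric.closedBall x 1) := by
  obtain ⟨y0, hy0⟩ := exists_nearFix_point hcat G hclosed htd
  have hD : 0 ≤ D := by
    obtain ⟨g, _, h⟩ := hcoc x x
    exact dist_nonneg.trans h
  obtain ⟨N, _, hNfin, hN⟩ := Metric.finite_approx_of_totallyBounded
    (isCompact_closedBall x (1 + (D + 2))).totallyBounded 1 one_pos
  choose γ hγ hγd using fun t => hcoc y0 t
  set A : Set X := (fun t => γ t y0) '' N with hA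
  have hAN : NearFix G A := by
    refine NearFix.finite (hNfin.image _) ?_
    rintro _ ⟨t, _, rfl⟩
    exact hy0.conj (hγ t)
  have hAd : ∀ z ∈ Metric.closedBall x (1 + (D + 2)), ∃ a ∈ A, dist z a ≤ D + 1 := by
    intro z hz
    obtain ⟨t, ht, hzt⟩ := mem_iUnion₂.1 (hN hz)
    refine ⟨γ t y0, mem_image_of_mem _ ht, ?_⟩
    have h1 := hγd t
    have h2 := dist_triangle z t (γ t y0)
    have h3 : dist z t < 1 := hzt
    linarith
  obtain ⟨F, δ, hδ, hF⟩ := hAN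
  refine ⟨F, δ, hδ, fun g0 hg0 hf => ?_⟩
  have hA0 := hF g0 hg0 hf
  set C : Set X := {y | g0 y = y} with hC
  have hCc : IsClosed C := isClosed_eq g0.continuous continuous_id
  intro y hy
  have hy1 : dist y x ≤ 1 := hy
  obtain ⟨a0, ha0, hya0⟩ := hAd y (by rw [Metric.mem_closedBall]; linarith)
  obtain ⟨p0, hp0, hpd⟩ := hCc.exists_infDist_eq_dist ⟨a0, hA0 a0 ha0⟩ y
  have hmin : ∀ q, g0 q = q → dist y p0 ≤ dist y q := fun q hq => by
    rw [← hpd]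
    exact Metric.infDist_le_dist_of_mem (show q ∈ C from hq)
  have hp0' : g0 p0 = p0 := hp0
  have hle : dist y p0 ≤ D + 1 := (hmin a0 (hA0 a0 ha0)).trans hya0
  by_cases ht : dist p0 y = 0
  · rw [← dist_eq_zero.1 ht]; exact hp0'
  exfalso
  have htp : 0 < dist p0 y := lt_of_le_of_ne dist_nonneg (Ne.symm ht)
  obtain ⟨c, hc, hc0, hc1⟩ := exists_line hcat hgc p0 y
  rw [dist_comm] at hle
  simp only [dist_comm y p0] at hmin
  set t := dist p0 y with htdef
  have hcT : dist (c (D + 2)) y = D + 2 - t := by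
    rw [← hc1, hc, abs_of_nonneg (by linarith)]
  obtain ⟨a, ha, had⟩ := hAd (c (D + 2)) (by
    rw [Metric.mem_closedBall]
    have := dist_triangle (c (D + 2)) y x
    linarith)
  obtain ⟨c2, hc2, hc20, hc21⟩ := exists_line hcat hgc p0 a
  have hl0 : 0 ≤ t / (D + 2) := by positivity
  have hl1 : t / (D + 2) ≤ 1 := by rw [div_le_one (by linarith)]; linarith
  have th := thales hcat hc hc2 (hc0.trans hc20.symm) (D + 2) (dist p0 a) (t / (D + 2)) hl0 hl1
  rw [div_mul_cancel₀ _ (by linarith), hc1, hc21] at th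
  set q := c2 (t / (D + 2) * dist p0 a) with hq
  have hL0 : 0 ≤ t / (D + 2) * dist p0 a := by positivity
  have hL1 : t / (D + 2) * dist p0 a ≤ dist p0 a := mul_le_of_le_one_left dist_nonneg hl1
  have q1 : dist p0 q = t / (D + 2) * dist p0 a := by
    rw [hq, ← hc20, hc2, zero_sub, abs_neg, abs_of_nonneg]
    rw [hc20]; exact hL0
  have q2 : dist q a = dist p0 a - t / (D + 2) * dist p0 a := by
    have : dist q (c2 (dist p0 a)) = dist p0 a - t / (D + 2) * dist p0 a := by
      rw [hq, hc2, abs_sub_comm, abs_of_nonneg (by linarith)]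
    rwa [hc21] at this
  have hgq : g0 q = q := by
    refine between_unique hcat (x := p0) (y := a) ?_ ?_ q1 q2
    · rw [← q1, ← g0.dist_eq p0 q, hp0']
    · rw [← q2, ← g0.dist_eq q a, hA0 a ha]
  have h1 := hmin q hgq
  have h2 : t / (D + 2) * dist (c (D + 2)) a ≤ t / (D + 2) * (D + 1) := by gcongr
  have h3 : t / (D + 2) * (D + 1) < t := by
    rw [div_mul_eq_mul_div, div_lt_iff₀ (by linarith)]
    nlinarith
  linarith

/-- finitely many restrictions of near elements to the unit ball -/
theorem finite_types [ProperSpace X] (G : Subgroup (X ≃ᵢ X)) (x : X) {A : Set X}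
    (h : NearFix G A) :
    ∃ S : Set (X ≃ᵢ X), S.Finite ∧ S ⊆ G ∧ ∀ g ∈ G, dist (g x) x ≤ 2 → ∃ s ∈ S, ∀ y ∈ A, g y = s y := by
  obtain ⟨F, δ, hδ, hF⟩ := h
  set E : Set (F → X) := (fun (g : X ≃ᵢ X) (f : F) => g f) '' {g | g ∈ G ∧ dist (g x) x ≤ 2} with hE
  have hEtb : TotallyBounded E := by
    have hc : IsCompact (Set.pi univ (fun f : F => Metric.closedBall x (2 + dist (f : X) x))) :=
      isCompact_univ_pi fun f => isCompact_closedBall _ _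
    refine hc.totallyBounded.subset ?_
    rintro _ ⟨g, ⟨_, hg⟩, rfl⟩ f _
    rw [Metric.mem_closedBall]
    have := dist_triangle (g f) (g x) x
    rw [g.dist_eq] at this
    linarith
  obtain ⟨N, hNE, hNfin, hN⟩ := Metric.finite_approx_of_totallyBounded hEtb δ hδ
  have : ∀ n ∈ N, ∃ g : X ≃ᵢ X, g ∈ G ∧ (fun (f : F) => g f) = n := by
    intro n hn
    obtain ⟨g, ⟨hg, _⟩, e⟩ := hNE hn
    exact ⟨g, hg, e⟩
  choose! s hsG hs using this
  refine ⟨s '' N, hNfin.image _, ?_, ?_⟩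
  · rintro _ ⟨n, hn, rfl⟩; exact hsG n hn
  · intro g hg hgx
    have : (fun (f : F) => g f) ∈ E := ⟨g, ⟨hg, hgx⟩, rfl⟩
    obtain ⟨n, hn, hgn⟩ := mem_iUnion₂.1 (hN this)
    refine ⟨s n, mem_image_of_mem _ hn, fun y hy => ?_⟩
    rw [← hs n hn, Metric.mem_ball, dist_pi_lt_iff hδ] at hgn
    have := hF ((s n)⁻¹ * g) (G.mul_mem (G.inv_mem (hsG n hn)) hg) (fun f hf => by
      rw [IsometryEquiv.mul_apply, ← (s n).dist_eq, IsometryEquiv.apply_inv_self]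
      exact hgn ⟨f, hf⟩) y hy
    rw [IsometryEquiv.mul_apply] at this
    have := congrArg (s n) this
    rwa [IsometryEquiv.apply_inv_self] at this

theorem separate {S : Set (X ≃ᵢ X)} (hS : S.Finite) {V : Set X} (hV : IsOpen V) (hne : V.Nonempty) :
    ∃ V' ⊆ V, IsOpen V' ∧ V'.Nonempty ∧ ∃ η > 0, ∀ s ∈ S,
      (∀ y ∈ V', s y = y) ∨ (∀ y ∈ V', η ≤ dist (s y) y) := by
  induction S, hS using Set.Finite.induction_on with
  | empty => exact ⟨V, Subset.rfl, hV, hne, 1, one_pos, by simp⟩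
  | @insert a S _ _ ih =>
    obtain ⟨V', h1, h2, h3, η, hη, h4⟩ := ih
    by_cases hfix : ∀ y ∈ V', a y = y
    · refine ⟨V', h1, h2, h3, η, hη, ?_⟩
      rintro s (rfl | hs)
      · exact Or.inl hfix
      · exact h4 s hs
    · push Not at hfix
      obtain ⟨y, hy, hay⟩ := hfix
      have hd : 0 < dist (a y) y := dist_pos.2 hay
      refine ⟨V' ∩ {z | dist (a y) y / 2 < dist (a z) z}, inter_subset_left.trans h1,
        h2.inter (isOpen_lt continuous_const (a.continuous.dist continuous_id)),
        ⟨y, hy, show dist (a y) y / 2 < dist (a y) y by linarith⟩,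
        min η (dist (a y) y / 2), lt_min hη (by linarith), ?_⟩
      rintro s (rfl | hs)
      · exact Or.inr fun z hz => (min_le_right _ _).trans (le_of_lt hz.2)
      · rcases h4 s hs with h | h
        · exact Or.inl fun z hz => h z hz.1
        · exact Or.inr fun z hz => (min_le_left _ _).trans (h z hz.1)

theorem good_open [ProperSpace X] [Nonempty X] (hcat : IsCAT0 X) (hgc : GeodesicallyComplete X)
    (G : Subgroup (X ≃ᵢ X))
    (hclosed : IsClosed (G : Set (X ≃ᵢ X))) (htd : TotallyDisconnectedSpace ↥G)
    {D : ℝ} (hcoc : ∀ x y : X, ∃ g ∈ G, dist y (g x) ≤ D) {V : Set X} (hV : IsOpen V)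
    (hne : V.Nonempty) :
    ∃ V' ⊆ V, IsOpen V' ∧ V'.Nonempty ∧ ∃ η > 0, ∀ z ∈ V', ∀ w ∈ V', ∀ g ∈ G,
      dist z (g w) < η → g w = w := by
  obtain ⟨x, hx⟩ := hne
  obtain ⟨S, hS, hSG, hST⟩ := finite_types G x (nearFix_ball hcat hgc G hclosed htd hcoc x)
  obtain ⟨V1, h1, h2, ⟨y, hy⟩, η, hη, h4⟩ := separate hS (hV.inter (Metric.isOpen_ball (x := x) (ε := 1/2)))
    ⟨x, hx, by simp⟩
  set r := min (1/3) (η/3) with hr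
  have hr0 : 0 < r := lt_min (by norm_num) (by linarith)
  have hr1 : r ≤ 1/3 := min_le_left _ _
  have hr2 : r ≤ η/3 := min_le_right _ _
  refine ⟨V1 ∩ Metric.ball y (r/2), inter_subset_left.trans (h1.trans inter_subset_left),
    h2.inter Metric.isOpen_ball, ⟨y, hy, Metric.mem_ball_self (by linarith)⟩, r, hr0, ?_⟩
  rintro z ⟨hz, hzy⟩ w ⟨hw, hwy⟩ g hg hzg
  have a1 : dist z y < r/2 := hzy
  have a2 : dist w y < r/2 := hwy
  have a3 : dist z x < 1/2 := (h1 hz).2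
  have a4 : dist w x < 1/2 := (h1 hw).2
  have b1 : dist (g x) x ≤ 2 := by
    have c1 := dist_triangle (g x) (g w) x
    have c2 := dist_triangle_left (g w) x z
    rw [g.dist_eq, dist_comm x w] at c1
    linarith
  obtain ⟨s, hs, hgs⟩ := hST g hg b1
  have e := hgs w (by rw [Metric.mem_closedBall]; linarith)
  rcases h4 s hs with h | h
  · rw [e, h w hw]
  · exfalso
    have c := h w hw
    rw [← e] at c
    have c2 := dist_triangle_left (g w) w z
    have c3 := dist_triangle_right z w y
    linarith

end CatGeo


theorem topDimE_le_of {Y : Type*} [TopologicalSpace Y] {n : ℕ} (h : DimLE Y n) :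
    topDimE Y ≤ n := iInf₂_le n h

theorem le_topDimE_of {Y : Type*} [TopologicalSpace Y] {n : ℕ} (h : ∀ k, DimLE Y k → n ≤ k) :
    (n : ℝ≥0∞) ≤ topDimE Y :=
  le_iInf₂ fun k hk => by exact_mod_cast h k hk

/-- dimensions of a separable metric space of Hausdorff dimension `≤ n` containing an `n`-cube -/
theorem dims_eq {Y : Type*} [MetricSpace Y] [SecondCountableTopology Y] {n : ℕ}
    (h : dimH (univ : Set Y) ≤ n) (e : ↥(Icc (0 : Fin n → ℝ) 1) → Y) (hec : Continuous e)
    (hei : Function.Injective e) : dimH (univ : Set Y) = n ∧ topDimE Y = n := by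
  have hc : ∀ k, DimLE Y k → n ≤ k := fun k hk => cube_dim_le e hec hei hk
  have hn : dimH (univ : Set Y) < (n : ℝ≥0∞) + 1 :=
    h.trans_lt (ENNReal.lt_add_right (ENNReal.natCast_ne_top n) one_ne_zero)
  refine ⟨le_antisymm h ?_, le_antisymm (topDimE_le_of (dimLE_of_dimH n hn)) (le_topDimE_of hc)⟩
  by_contra hlt
  rw [not_le] at hlt
  rcases n with _ | m
  · simp at hlt
  · have := hc m (dimLE_of_dimH m (by exact_mod_cast hlt))
    omega

/-- Let `X` be a proper geodesically complete CAT(0) space and `Γ` a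
closed, cocompact, totally disconnected group of isometries.  Then the quotient metric space
`M = Γ\X` satisfies `HD(M) = HD(X) = TD(X) = TD(M)`. -/
theorem stmt13 {X : Type*} [MetricSpace X] [ProperSpace X]
    (hcat : IsCAT0 X) (hgc : GeodesicallyComplete X)
    (G : Subgroup (X ≃ᵢ X))
    (hclosed : IsClosed (G : Set (X ≃ᵢ X)))
    (htd : TotallyDisconnectedSpace ↥G)
    {D : ℝ} (hcoc : ∀ x y : X, ∃ g ∈ G, dist y (g x) ≤ D)
    (M : Type*) [MetricSpace M] (p : X → M) (hsurj : Function.Surjective p)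
    (hdist : ∀ x y : X, dist (p x) (p y) = sInf {r : ℝ | ∃ g ∈ G, r = dist x (g y)}) :
    dimH (univ : Set M) = dimH (univ : Set X) ∧
    dimH (univ : Set X) = topDimE X ∧
    topDimE X = topDimE M := by
  have hlip : LipschitzWith 1 p := by
    refine LipschitzWith.of_dist_le_mul fun x y => ?_
    rw [hdist, NNReal.coe_one, one_mul]
    refine csInf_le ⟨0, ?_⟩ ⟨1, G.one_mem, by simp⟩
    rintro r ⟨g, _, rfl⟩
    exact dist_nonneg
  have hsep : TopologicalSpace.SeparableSpace M :=
    hsurj.denseRange.separableSpace hlip.continuous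
  have hsc : SecondCountableTopology M := UniformSpace.secondCountable_of_separable M
  rcases isEmpty_or_nonempty X with hX | hX
  · have hM : IsEmpty M := ⟨fun m => (hsurj m).elim fun x _ => hX.elim x⟩
    have tX : topDimE X = 0 := by
      refine le_antisymm ?_ bot_le
      have := topDimE_le_of (dimLE_of_dimH (Y := X) 0 (by
        rw [univ_eq_empty_iff.2 inferInstance, dimH_empty]; simp))
      simpa using this
    have tM : topDimE M = 0 := by
      refine le_antisymm ?_ bot_le
      have := topDimE_le_of (dimLE_of_dimH (Y := M) 0 (by
        rw [univ_eq_empty_iff.2 inferInstance, dimH_empty]; simp))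
      simpa using this
    rw [tX, tM, univ_eq_empty_iff.2 hX, univ_eq_empty_iff.2 hM, dimH_empty, dimH_empty]
    exact ⟨rfl, rfl, rfl⟩
  · obtain ⟨n, hn, V, hV, hVne, hcube⟩ := CatGeo.strain_main hcat hgc (D := D) (fun x y => by
      obtain ⟨g, _, h⟩ := hcoc x y
      exact ⟨g, h⟩)
    obtain ⟨V', hV'V, hV', hV'ne, η, hη, hfix⟩ :=
      CatGeo.good_open hcat hgc G hclosed htd hcoc hV hVne
    obtain ⟨e, hec, hei, heV⟩ := hcube V' hV'V hV' hV'ne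
    have hinj : ∀ z ∈ V', ∀ w ∈ V', p z = p w → z = w := by
      intro z hz w hw hzw
      have h0 : sInf {r : ℝ | ∃ g ∈ G, r = dist z (g w)} = 0 := by
        rw [← hdist, hzw, dist_self]
      by_contra hne
      have hd : 0 < min η (dist z w) := lt_min hη (dist_pos.2 hne)
      rw [← h0] at hd
      obtain ⟨r, ⟨g, hg, rfl⟩, hr⟩ := exists_lt_of_csInf_lt
        (s := {r : ℝ | ∃ g ∈ G, r = dist z (g w)}) ⟨dist z ((1 : X ≃ᵢ X) w), 1, G.one_mem, rfl⟩ hd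
      have h1 := hfix z hz w hw g hg (hr.trans_le (min_le_left _ _))
      have h2 := hr.trans_le (min_le_right _ _)
      rw [h1] at h2
      exact lt_irrefl _ h2
    have hM : dimH (univ : Set M) ≤ n := by
      have := hlip.dimH_range_le
      rw [hsurj.range_eq] at this
      exact this.trans hn
    obtain ⟨x1, x2⟩ := dims_eq hn e hec hei
    obtain ⟨m1, m2⟩ := dims_eq hM (p ∘ e) (hlip.continuous.comp hec)
      (fun u v h => hei (hinj _ (heV u) _ (heV v) h))
    rw [x1, x2, m1, m2]
    exact ⟨rfl, rfl, rfl⟩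
end
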